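/- For every positive integer n, the number of representations of n by x1^2 + x2^2 + x3^2 + x4^2 + x5^2 + x6^2 + 2x7^2 + 4x8^2 equals (64/11)σ_{3;χ8,1}(n) + (2/11)σ_{3;1,χ8}(n/2) − (28/11)a1(n) + (96/11)a2(n) + (224/11)a1(n/2) + (192/11)a2(n/2), with terms of non-integer argument interpreted as 0. -/

import Mathlib

open Complex Real Finset

/-- The Dedekind eta function `η(z) = q^{1/24} ∏ (1 - q^m)`, `q = e^{2πiz}`. -/
noncomputable def dedekindEta (z : ℂ) : ℂ :=
  Complex.exp (Real.pi * Complex.I * z / 12) *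
    ∏' m : ℕ, (1 - Complex.exp (2 * Real.pi * Complex.I * (m + 1) * z))

/-- `repCount a n` is the number of `(x₁,…,x₈) ∈ ℤ⁸` with `∑ aᵢ xᵢ² = n`. -/
noncomputable def repCount (a : Fin 8 → ℕ) (n : ℕ) : ℕ :=
  Nat.card {x : Fin 8 → ℤ // ∑ i, (a i : ℤ) * x i ^ 2 = (n : ℤ)}

/-- `σ_{3;1,χ₈}(n) = ∑_{d ∣ n} χ₈(d) d³`. -/
def sigmaOneChi8 (n : ℕ) : ℤ := ∑ d ∈ n.divisors, ZMod.χ₈ (d : ZMod 8) * (d : ℤ) ^ 3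

/-- `σ_{3;χ₈,1}(n) = ∑_{d ∣ n} χ₈(n/d) d³`. -/
def sigmaChi8One (n : ℕ) : ℤ := ∑ d ∈ n.divisors, ZMod.χ₈ ((n / d : ℕ) : ZMod 8) * (d : ℤ) ^ 3

/-- `f(n/2)` when `2 ∣ n`, and `0` otherwise. -/
def half (f : ℕ → ℤ) (n : ℕ) : ℚ := if 2 ∣ n then (f (n / 2) : ℚ) else 0

namespace RF

/-- The `q`-Pochhammer symbol `(x;p)_∞`. -/
noncomputable def P (x p : ℂ) : ℂ := ∏' n : ℕ, (1 - x * p ^ n)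

lemma summable_geo (x : ℂ) {p : ℂ} (hp : ‖p‖ < 1) : Summable fun n : ℕ => ‖x * p ^ n‖ := by
  simp only [norm_mul, norm_pow]
  exact (summable_geometric_of_lt_one (norm_nonneg _) hp).mul_left _

lemma P_mult (x : ℂ) {p : ℂ} (hp : ‖p‖ < 1) : Multipliable fun n : ℕ => (1 - x * p ^ n) := by
  simp only [sub_eq_add_neg]
  apply multipliable_one_add_of_summable
  simpa using summable_geo x hp

lemma P_ne_zero {x p : ℂ} (hp : ‖p‖ < 1) (h : ∀ n : ℕ, x * p ^ n ≠ 1) : P x p ≠ 0 := by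
  have := tprod_one_add_ne_zero_of_summable (f := fun n : ℕ => -(x * p ^ n)) ?_ ?_
  · simpa [P, sub_eq_add_neg] using this
  · intro i
    rw [← sub_eq_add_neg, sub_ne_zero]
    exact (h i).symm
  · simpa using summable_geo x hp

lemma P_succ (x : ℂ) {p : ℂ} (hp : ‖p‖ < 1) : P x p = (1 - x) * P (x * p) p := by
  have h := (P_mult (x * p) hp)
  have e : (fun n : ℕ => (1 - x * p * p ^ n)) = fun n : ℕ => (1 - x * p ^ (n + 1)) := by
    funext n; rw [pow_succ']; ring
  unfold P
  rw [e] at h ⊢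
  have := tprod_eq_zero_mul' (f := fun n : ℕ => (1 - x * p ^ n)) h
  rw [this, pow_zero, mul_one]

lemma P_one {p : ℂ} (hp : ‖p‖ < 1) : P 1 p = 0 := by rw [P_succ 1 hp]; simp

lemma P_neg_mul (x : ℂ) {p : ℂ} (hp : ‖p‖ < 1) : P x p * P (-x) p = P (x ^ 2) (p ^ 2) := by
  unfold P
  rw [← (P_mult x hp).tprod_mul (P_mult (-x) hp)]
  congr 1
  ext n
  ring

lemma P_dissect (x : ℂ) {p : ℂ} (hp : ‖p‖ < 1) :
    P x p = P x (p ^ 2) * P (x * p) (p ^ 2) := by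
  have hp2 : ‖p ^ 2‖ < 1 := by
    rw [norm_pow]; exact pow_lt_one₀ (norm_nonneg _) hp two_ne_zero
  unfold P
  rw [← tprod_even_mul_odd (f := fun n : ℕ => (1 - x * p ^ n))]
  · congr 2 <;> ext n <;> ring
  · convert P_mult x hp2 using 2 with n; ring
  · convert P_mult (x * p) hp2 using 2 with n; ring

/-- The Euler product `∏ (1 - q^n)`. -/
noncomputable def E (q : ℂ) : ℂ := P q q

lemma pow_ne_one_of_norm {q : ℂ} (hq : ‖q‖ < 1) {n : ℕ} (hn : n ≠ 0) : q ^ n ≠ 1 := by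
  intro h
  have := congrArg norm h
  rw [norm_pow, norm_one] at this
  exact absurd this (pow_lt_one₀ (norm_nonneg _) hq hn).ne

lemma norm_pow_lt {q : ℂ} (hq : ‖q‖ < 1) {n : ℕ} (hn : n ≠ 0) : ‖q ^ n‖ < 1 := by
  rw [norm_pow]; exact pow_lt_one₀ (norm_nonneg _) hq hn

lemma E_ne_zero {q : ℂ} (hq : ‖q‖ < 1) : E q ≠ 0 := by
  apply P_ne_zero hq
  intro n
  rw [← pow_succ']
  exact pow_ne_one_of_norm hq (by omega)

/-- `(q;q²) = e₁/e₂`. -/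
lemma P_odd {q : ℂ} (hq : ‖q‖ < 1) : P q (q ^ 2) * E (q ^ 2) = E q := by
  unfold E
  rw [P_dissect q hq, ← pow_two]

/-- `(-q;q) = e₂/e₁`. -/
lemma P_neg_self {q : ℂ} (hq : ‖q‖ < 1) : E q * P (-q) q = E (q ^ 2) := by
  unfold E
  rw [P_neg_mul q hq]

end RF

namespace RF
open Filter Topology

lemma summable_theta_nat {r c : ℂ} (hr0 : r ≠ 0) (hr : ‖r‖ < 1) (hc : c ≠ 0) :
    Summable fun n : ℕ => r ^ ((n : ℤ) ^ 2 - n) * c ^ (n : ℤ) := by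
  apply summable_of_ratio_test_tendsto_lt_one (l := 0) zero_lt_one
  · refine Eventually.of_forall fun n => ?_
    positivity
  · have h : ∀ n : ℕ, ‖r ^ (((n + 1 : ℕ) : ℤ) ^ 2 - ((n + 1 : ℕ) : ℤ)) * c ^ ((n + 1 : ℕ) : ℤ)‖ /
        ‖r ^ ((n : ℤ) ^ 2 - n) * c ^ (n : ℤ)‖ = ‖c‖ * ‖r ^ 2‖ ^ n := by
      intro n
      have e : (((n + 1 : ℕ) : ℤ) ^ 2 - ((n + 1 : ℕ) : ℤ)) = ((n : ℤ) ^ 2 - n) + (2 * n : ℕ) := by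
        push_cast; ring
      rw [e, zpow_add₀ hr0, ← norm_div, ← norm_pow, ← norm_mul]
      congr 1
      have h1 : r ^ ((n : ℤ) ^ 2 - n) ≠ 0 := zpow_ne_zero _ hr0
      rw [zpow_natCast, zpow_natCast, zpow_natCast]
      field_simp
      ring
    simp only [h]
    have := (tendsto_pow_atTop_nhds_zero_of_lt_one (norm_nonneg _)
      (norm_pow_lt hr two_ne_zero)).const_mul ‖c‖
    simpa using this

/-- term of the theta series -/
noncomputable def tt (r a : ℂ) (n : ℤ) : ℂ := (-1) ^ n * r ^ (n ^ 2 - n) * a ^ n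

lemma summable_tt {r a : ℂ} (hr0 : r ≠ 0) (hr : ‖r‖ < 1) (ha : a ≠ 0) :
    Summable fun n : ℤ => ‖tt r a n‖ := by
  have h : Summable fun n : ℤ => r ^ (n ^ 2 - n) * a ^ n := by
    apply Summable.of_nat_of_neg
    · exact summable_theta_nat hr0 hr ha
    · have := summable_theta_nat hr0 hr (c := r ^ 2 / a) (by positivity)
      refine this.congr fun n => ?_
      have e : (-(n : ℤ)) ^ 2 - (-n) = ((n : ℤ) ^ 2 - n) + (2 * n : ℕ) := by push_cast; ring
      rw [e, zpow_add₀ hr0, zpow_neg, zpow_natCast, zpow_natCast, zpow_natCast, div_pow]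
      field_simp
      ring
  refine h.norm.congr fun n => ?_
  simp [tt]

/-- The theta series. -/
noncomputable def Th (r a : ℂ) : ℂ := ∑' n : ℤ, tt r a n

/-- `(p)_n` -/
noncomputable def ff (p : ℂ) (n : ℕ) : ℂ := ∏ k ∈ range n, (1 - p ^ (k + 1))

lemma ff_ne {p : ℂ} (hp : ‖p‖ < 1) (n : ℕ) : ff p n ≠ 0 := by
  unfold ff
  rw [prod_ne_zero_iff]
  intro k _
  rw [sub_ne_zero]
  exact (pow_ne_one_of_norm hp (by omega)).symm

lemma ff_succ (p : ℂ) (n : ℕ) : ff p (n + 1) = ff p n * (1 - p ^ (n + 1)) := by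
  unfold ff; rw [prod_range_succ]

/-- Gaussian binomial -/
noncomputable def gb (p : ℂ) (M j : ℕ) : ℂ := if j ≤ M then ff p M / (ff p j * ff p (M - j)) else 0

lemma gb_zero {p : ℂ} (hp : ‖p‖ < 1) (M : ℕ) : gb p M 0 = 1 := by
  have := ff_ne hp M
  have h0 : ff p 0 = 1 := by simp [ff]
  rw [gb, if_pos (Nat.zero_le _), h0, one_mul, Nat.sub_zero, div_self this]

lemma gb_pascal {p : ℂ} (hp : ‖p‖ < 1) (M j : ℕ) (hj : j ≤ M) :
    gb p (M + 1) (j + 1) = gb p M (j + 1) + p ^ (M - j) * gb p M j := by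
  have h1 := ff_ne hp M
  have h2 := ff_ne hp j
  rcases hj.lt_or_eq with h | rfl
  · obtain ⟨d, rfl⟩ : ∃ d, M = j + 1 + d := ⟨M - (j + 1), by omega⟩
    have h3 := ff_ne hp d
    have h4 := ff_ne hp (d + 1)
    have h5 := ff_ne hp (j + 1)
    have e1 : j + 1 + d + 1 - (j + 1) = d + 1 := by omega
    have e2 : j + 1 + d - (j + 1) = d := by omega
    have e3 : j + 1 + d - j = d + 1 := by omega
    unfold gb
    rw [if_pos (by omega), if_pos (by omega), if_pos (by omega), e1, e2, e3]
    rw [ff_succ p (j + 1 + d)]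
    rw [ff_succ] at h4 h5
    have h6 := right_ne_zero_of_mul h4
    have h7 := right_ne_zero_of_mul h5
    rw [ff_succ p d, ff_succ p j]
    field_simp
    ring
  · have h5 := ff_ne hp (j + 1)
    have h0 : ff p 0 = 1 := by simp [ff]
    simp [gb, h0, h1, h5]

lemma gauss {r : ℂ} (hr : ‖r‖ < 1) (x : ℂ) (M : ℕ) :
    ∏ k ∈ range M, (1 + x * (r ^ 2) ^ k) =
      ∑ j ∈ range (M + 1), gb (r ^ 2) M j * r ^ (j * (j - 1)) * x ^ j := by
  have hp := norm_pow_lt hr two_ne_zero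
  induction M with
  | zero => simp [gb, ff]
  | succ M ih =>
    rw [prod_range_succ, ih, sum_range_succ' _ (M + 1)]
    have hstep : ∀ j ∈ range (M + 1),
        gb (r ^ 2) (M + 1) (j + 1) * r ^ ((j + 1) * (j + 1 - 1)) * x ^ (j + 1) =
        gb (r ^ 2) M (j + 1) * r ^ ((j + 1) * (j + 1 - 1)) * x ^ (j + 1) +
        gb (r ^ 2) M j * r ^ (j * (j - 1)) * x ^ j * (x * (r ^ 2) ^ M) := by
      intro j hj
      have hj' : j ≤ M := by simp at hj; omega
      rw [gb_pascal hp M j hj']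
      obtain ⟨d, rfl⟩ := Nat.exists_eq_add_of_le hj'
      have e1 : j + d - j = d := by omega
      have e2 : (j + 1) * (j + 1 - 1) = j * (j - 1) + 2 * j := by
        rcases j with _ | j
        · simp
        · simp; ring
      rw [e1, e2]
      ring
    rw [sum_congr rfl hstep, sum_add_distrib, ← sum_mul]
    have h2 : ∑ j ∈ range (M + 1), gb (r ^ 2) M j * r ^ (j * (j - 1)) * x ^ j =
       ∑ j ∈ range (M + 1), gb (r ^ 2) M (j + 1) * r ^ ((j + 1) * (j + 1 - 1)) * x ^ (j + 1) + 1 := by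
      have := sum_range_succ' (fun j => gb (r ^ 2) M j * r ^ (j * (j - 1)) * x ^ j) (M + 1)
      rw [sum_range_succ] at this
      simp only [gb_zero hp] at this
      have z : gb (r ^ 2) M (M + 1) = 0 := by simp [gb]
      rw [z] at this
      simpa using this
    rw [mul_add, mul_one, gb_zero hp]
    simp only [Nat.zero_mul, pow_zero, mul_one]
    rw [h2]
    ring

lemma prod_neg_part {r a : ℂ} (hr0 : r ≠ 0) (ha : a ≠ 0) (N : ℕ) :
    ∏ k ∈ range (2 * N), (1 + (-a * r ^ (-2 * N : ℤ)) * (r ^ 2) ^ k) =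
      (-a) ^ N * r ^ (-(N * (N + 1)) : ℤ) *
      ((∏ k ∈ range N, (1 - a * (r ^ 2) ^ k)) * ∏ k ∈ range N, (1 - (r ^ 2 / a) * (r ^ 2) ^ k)) := by
  rw [two_mul, prod_range_add]
  have h1 : ∏ k ∈ range N, (1 + (-a * r ^ (-2 * N : ℤ)) * (r ^ 2) ^ (N + k)) =
      ∏ k ∈ range N, (1 - a * (r ^ 2) ^ k) := by
    refine prod_congr rfl fun k _ => ?_
    have : r ^ (-2 * N : ℤ) * (r ^ 2) ^ (N + k) = (r ^ 2) ^ k := by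
      rw [pow_add, ← mul_assoc, ← pow_mul r 2 N, ← zpow_natCast r (2 * N), ← zpow_add₀ hr0]
      simp
    rw [mul_assoc, this]; ring
  have h2 : ∏ k ∈ range N, (1 + (-a * r ^ (-2 * N : ℤ)) * (r ^ 2) ^ k) =
      (-a) ^ N * r ^ (-(N * (N + 1)) : ℤ) * ∏ k ∈ range N, (1 - (r ^ 2 / a) * (r ^ 2) ^ k) := by
    rw [← prod_range_reflect]
    have : ∀ k ∈ range N, (1 + (-a * r ^ (-2 * N : ℤ)) * (r ^ 2) ^ (N - 1 - k)) =
        (-a * r ^ (-2 * (k + 1) : ℤ)) * (1 - (r ^ 2 / a) * (r ^ 2) ^ k) := by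
      intro k hk
      obtain ⟨d, rfl⟩ : ∃ d, N = k + 1 + d := ⟨N - (k + 1), by simp at hk; omega⟩
      have e : k + 1 + d - 1 - k = d := by omega
      rw [e]
      have e2 : r ^ (-2 * ((k + 1 + d : ℕ) : ℤ) : ℤ) * (r ^ 2) ^ d = r ^ (-2 * (k + 1) : ℤ) := by
        rw [← pow_mul, ← zpow_natCast r (2 * d), ← zpow_add₀ hr0]
        congr 1; push_cast; ring
      rw [mul_assoc, e2]
      have e3 : r ^ (-2 * (k + 1) : ℤ) * (r ^ 2 * (r ^ 2) ^ k) = 1 := by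
        rw [← pow_succ', ← pow_mul, ← zpow_natCast r, ← zpow_add₀ hr0]
        have : (-2 * (k + 1) + ((2 * (k + 1) : ℕ) : ℤ) : ℤ) = 0 := by push_cast; ring
        rw [this, zpow_zero]
      have e4 : (-a * r ^ (-2 * (k + 1) : ℤ)) * (1 - (r ^ 2 / a) * (r ^ 2) ^ k) =
        -a * r ^ (-2 * (k + 1) : ℤ) + a / a * (r ^ (-2 * (k + 1) : ℤ) * (r ^ 2 * (r ^ 2) ^ k)) := by
        ring
      rw [e4, e3, div_self ha]; ring
    rw [prod_congr rfl this, prod_mul_distrib]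
    congr 1
    clear this h1
    induction N with
    | zero => simp
    | succ N ih =>
      rw [prod_range_succ, ih, pow_succ]
      have : r ^ (-((N + 1 : ℕ) * ((N + 1 : ℕ) + 1)) : ℤ) =
          r ^ (-(N * (N + 1)) : ℤ) * r ^ (-2 * (N + 1) : ℤ) := by
        rw [← zpow_add₀ hr0]; congr 1; push_cast; ring
      rw [this]; ring
  rw [h1, h2]; ring

/-- coefficients of the finite triple product -/
noncomputable def uu (p : ℂ) (N : ℕ) (m : ℤ) : ℂ :=
  if m ∈ Finset.Icc (-(N : ℤ)) N then ff p (2 * N) / (ff p (m + N).toNat * ff p (N - m).toNat) else 0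

lemma finite_jtp {r a : ℂ} (hr0 : r ≠ 0) (hr : ‖r‖ < 1) (ha : a ≠ 0) (N : ℕ) :
    (∏ k ∈ range N, (1 - a * (r ^ 2) ^ k)) * ∏ k ∈ range N, (1 - (r ^ 2 / a) * (r ^ 2) ^ k) =
      ∑' m : ℤ, uu (r ^ 2) N m * tt r a m := by
  have hs : ∑' m : ℤ, uu (r ^ 2) N m * tt r a m =
      ∑ m ∈ Finset.Icc (-(N : ℤ)) N, uu (r ^ 2) N m * tt r a m := by
    apply tsum_eq_sum
    intro m hm
    rw [uu, if_neg hm, zero_mul]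
  have h := prod_neg_part hr0 ha N
  rw [gauss hr] at h
  have hne : (-a) ^ N * r ^ (-(N * (N + 1)) : ℤ) ≠ 0 := by
    have := zpow_ne_zero (-(N * (N + 1)) : ℤ) hr0
    have h2 : (-a) ^ N ≠ 0 := pow_ne_zero _ (neg_ne_zero.mpr ha)
    positivity
  apply mul_left_cancel₀ hne
  rw [← h, hs, mul_sum]
  refine sum_nbij' (fun j => (j : ℤ) - N) (fun m => (m + N).toNat) ?_ ?_ ?_ ?_ ?_
  · intro j hj; simp at hj ⊢; omega
  · intro m hm; simp at hm ⊢; omega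
  · intro j hj; simp
  · intro m hm; simp at hm ⊢; omega
  · intro j hj
    have hj' : j ≤ 2 * N := by simp at hj; omega
    have e1 : ((j : ℤ) - N) ∈ Finset.Icc (-(N : ℤ)) N := by simp; omega
    have e2 : ((j : ℤ) - N + N).toNat = j := by simp
    have e3 : ((N : ℤ) - (j - N)).toNat = 2 * N - j := by omega
    rw [uu, if_pos e1, e2, e3, gb, if_pos hj', tt]
    have hj2 : ((j * (j - 1) : ℕ) : ℤ) = (j : ℤ) ^ 2 - j := by
      rcases j with _ | j
      · simp
      · rw [Nat.add_sub_cancel]; push_cast; ring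
    have hx : r ^ (j * (j - 1)) * (-a * r ^ (-2 * N : ℤ)) ^ j =
        (-a) ^ N * r ^ (-(N * (N + 1)) : ℤ) *
        ((-1) ^ ((j : ℤ) - N) * r ^ (((j : ℤ) - N) ^ 2 - ((j : ℤ) - N)) * a ^ ((j : ℤ) - N)) := by
      rw [mul_pow, ← zpow_natCast (r ^ (-2 * N : ℤ)), ← zpow_mul, ← zpow_natCast r, hj2]
      have e5 : (-1 : ℂ) ^ ((j : ℤ) - N) * a ^ ((j : ℤ) - N) = (-a) ^ j / (-a) ^ N := by
        rw [← mul_zpow, zpow_sub₀ (by simpa using ha)]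
        simp
      have e6 : r ^ (-(N * (N + 1)) : ℤ) * r ^ (((j : ℤ) - N) ^ 2 - ((j : ℤ) - N)) =
          r ^ ((j : ℤ) ^ 2 - j) * r ^ (-2 * N * j : ℤ) := by
        rw [← zpow_add₀ hr0, ← zpow_add₀ hr0]; congr 1; ring
      have h2 : (-a) ^ N ≠ 0 := pow_ne_zero _ (neg_ne_zero.mpr ha)
      calc _ = (-a) ^ j * (r ^ ((j : ℤ) ^ 2 - j) * r ^ (-2 * N * j : ℤ)) := by ring
        _ = (-a) ^ N * ((-a) ^ j / (-a) ^ N) * (r ^ (-(N * (N + 1)) : ℤ) *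
            r ^ (((j : ℤ) - N) ^ 2 - ((j : ℤ) - N))) := by rw [e6]; field_simp
        _ = _ := by rw [← e5]; ring
    rw [mul_assoc, hx]
    ring

lemma ff_tendsto {p : ℂ} (hp : ‖p‖ < 1) : Tendsto (ff p) atTop (𝓝 (E p)) := by
  have := (P_mult p hp).hasProd.tendsto_prod_nat
  refine this.congr fun n => ?_
  unfold ff
  refine prod_congr rfl fun k _ => ?_
  rw [pow_succ']

lemma bdd_of_tendsto {f : ℕ → ℂ} {l : ℂ} (h : Tendsto f atTop (𝓝 l)) :
    ∃ C, 0 ≤ C ∧ ∀ n, ‖f n‖ ≤ C := by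
  obtain ⟨C, hC⟩ := (Metric.isBounded_range_of_tendsto f h).exists_norm_le
  exact ⟨max C 0, le_max_right _ _, fun n => (hC _ ⟨n, rfl⟩).trans (le_max_left _ _)⟩

/-- Jacobi triple product -/
theorem jtp {r a : ℂ} (hr0 : r ≠ 0) (hr : ‖r‖ < 1) (ha : a ≠ 0) :
    Th r a = E (r ^ 2) * P a (r ^ 2) * P (r ^ 2 / a) (r ^ 2) := by
  have hp := norm_pow_lt hr two_ne_zero
  have hE := E_ne_zero hp
  have hf := ff_tendsto hp
  have hfi := hf.inv₀ hE
  obtain ⟨C, hC0, hC⟩ := bdd_of_tendsto hf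
  obtain ⟨D, hD0, hD⟩ := bdd_of_tendsto hfi
  have lhs : Tendsto (fun N => (∏ k ∈ range N, (1 - a * (r ^ 2) ^ k)) *
      ∏ k ∈ range N, (1 - (r ^ 2 / a) * (r ^ 2) ^ k)) atTop
      (𝓝 (P a (r ^ 2) * P (r ^ 2 / a) (r ^ 2))) :=
    (P_mult a hp).hasProd.tendsto_prod_nat.mul (P_mult (r ^ 2 / a) hp).hasProd.tendsto_prod_nat
  have rhs : Tendsto (fun N => ∑' m : ℤ, uu (r ^ 2) N m * tt r a m) atTop
      (𝓝 (∑' m : ℤ, (E (r ^ 2))⁻¹ * tt r a m)) := by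
    apply tendsto_tsum_of_dominated_convergence (bound := fun m => C * (D * D) * ‖tt r a m‖)
    · exact (summable_tt hr0 hr ha).mul_left _
    · intro m
      apply Tendsto.mul_const
      have h1 : Tendsto (fun N : ℕ => 2 * N) atTop atTop :=
        tendsto_atTop_mono (fun N => by simp only [id]; omega) tendsto_id
      have h2 : Tendsto (fun N : ℕ => (m + N).toNat) atTop atTop := by
        rw [tendsto_atTop]
        intro b
        filter_upwards [eventually_ge_atTop (b + m.natAbs)] with N hN
        omega
      have h3 : Tendsto (fun N : ℕ => ((N : ℤ) - m).toNat) atTop atTop := by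
        rw [tendsto_atTop]
        intro b
        filter_upwards [eventually_ge_atTop (b + m.natAbs)] with N hN
        omega
      have := (hf.comp h1).mul ((hfi.comp h2).mul (hfi.comp h3))
      have e : E (r ^ 2) * ((E (r ^ 2))⁻¹ * (E (r ^ 2))⁻¹) = (E (r ^ 2))⁻¹ := by field_simp
      rw [e] at this
      refine this.congr' ?_
      filter_upwards [eventually_ge_atTop m.natAbs] with N hN
      rw [uu, if_pos (by simp; omega)]
      simp only [Function.comp, div_eq_mul_inv, mul_inv]
    · refine Eventually.of_forall fun N m => ?_
      rw [norm_mul]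
      gcongr
      unfold uu
      split_ifs
      · rw [div_eq_mul_inv, mul_inv, norm_mul, norm_mul]
        gcongr
        · exact hC _
        · exact hD _
        · exact hD _
      · simp; positivity
  have := tendsto_nhds_unique lhs (rhs.congr fun N => (finite_jtp hr0 hr ha N).symm)
  rw [tsum_mul_left] at this
  rw [mul_assoc, this, Th]
  field_simp

end RF

namespace RF
open Filter Topology

/-- splitting of the lattice by parity of the coordinate sum -/
noncomputable def parityEquiv : (ℤ × ℤ) ⊕ (ℤ × ℤ) ≃ ℤ × ℤ :=
  Equiv.ofBijective (Sum.elim (fun x => (x.1 + x.2, x.1 - x.2)) (fun x => (x.1 + x.2 + 1, x.1 - x.2))) (by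
    constructor
    · rintro (⟨a, b⟩ | ⟨a, b⟩) (⟨c, d⟩ | ⟨c, d⟩) h <;> simp at h ⊢ <;> omega
    · rintro ⟨m, n⟩
      rcases Int.even_or_odd (m + n) with h | h
      · obtain ⟨k, hk⟩ := h
        exact ⟨Sum.inl (k, m - k), by simp; omega⟩
      · obtain ⟨k, hk⟩ := h
        exact ⟨Sum.inr (k, k - n), by simp; omega⟩)

lemma parityEquiv_inl (k l : ℤ) : parityEquiv (Sum.inl (k, l)) = (k + l, k - l) := rfl

lemma parityEquiv_inr (k l : ℤ) : parityEquiv (Sum.inr (k, l)) = (k + l + 1, k - l) := rfl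

lemma hasSum_congr_fun {α : Type*} {f g : α → ℂ} {a : ℂ} (h : ∀ x, f x = g x) (hg : HasSum g a) :
    HasSum f a := by
  rwa [funext h]

lemma hasSum_tt {r a : ℂ} (hr0 : r ≠ 0) (hr : ‖r‖ < 1) (ha : a ≠ 0) :
    HasSum (tt r a) (Th r a) := (summable_tt hr0 hr ha).of_norm.hasSum

lemma hasSum_tt_mul {r a b r' : ℂ} (hr0 : r ≠ 0) (hr : ‖r‖ < 1) (ha : a ≠ 0)
    (hr0' : r' ≠ 0) (hr' : ‖r'‖ < 1) (hb : b ≠ 0) :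
    HasSum (fun x : ℤ × ℤ => tt r a x.1 * tt r' b x.2) (Th r a * Th r' b) :=
  (hasSum_tt hr0 hr ha).mul (hasSum_tt hr0' hr' hb)
    (summable_mul_of_summable_norm (summable_tt hr0 hr ha) (summable_tt hr0' hr' hb))

lemma Th_shift {r a : ℂ} (hr0 : r ≠ 0) (ha : a ≠ 0) :
    a * Th r (r ^ 2 * a) = - Th r a := by
  unfold Th
  rw [← tsum_mul_left, ← tsum_neg, ← (Equiv.addRight (1 : ℤ)).tsum_eq (fun n => -tt r a n)]
  refine tsum_congr fun n => ?_
  simp only [tt, Equiv.coe_addRight]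
  have e : ((n + 1) ^ 2 - (n + 1) : ℤ) = (n ^ 2 - n) + 2 * n := by ring
  have e2 : ((r ^ 2 : ℂ)) ^ n = r ^ (2 * n) := by
    rw [zpow_mul]; norm_cast
  rw [e, zpow_add₀ hr0, zpow_add_one₀ ha, zpow_add_one₀ (by norm_num), mul_zpow, e2]
  ring

lemma neg_one_zpow_even (k : ℤ) : (-1 : ℂ) ^ (2 * k) = 1 := by
  rw [zpow_mul]; norm_num

/-- `[a b] = b Th(ab) Th(a/b) = U(a) V(b) - V(a) U(b)` -/
lemma double_sum {r a b : ℂ} (hr0 : r ≠ 0) (hr : ‖r‖ < 1) (ha : a ≠ 0) (hb : b ≠ 0) :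
    b * (Th r (a * b) * Th r (a / b)) =
      Th (r ^ 2) (-a ^ 2) * (b * Th (r ^ 2) (-(r ^ 2 * b ^ 2))) -
      (a * Th (r ^ 2) (-(r ^ 2 * a ^ 2))) * Th (r ^ 2) (-b ^ 2) := by
  have hp0 : r ^ 2 ≠ 0 := pow_ne_zero _ hr0
  have hp := norm_pow_lt hr two_ne_zero
  have a2 : -a ^ 2 ≠ 0 := neg_ne_zero.mpr (pow_ne_zero _ ha)
  have a3 : -(r ^ 2 * a ^ 2) ≠ 0 := neg_ne_zero.mpr (mul_ne_zero hp0 (pow_ne_zero _ ha))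
  have b3 : -(r ^ 2 * b ^ 2) ≠ 0 := neg_ne_zero.mpr (mul_ne_zero hp0 (pow_ne_zero _ hb))
  have b4 : -((r ^ 2) ^ 2 * b ^ 2) ≠ 0 :=
    neg_ne_zero.mpr (mul_ne_zero (pow_ne_zero _ hp0) (pow_ne_zero _ hb))
  have h1 := hasSum_tt_mul hr0 hr (mul_ne_zero ha hb) hr0 hr (div_ne_zero ha hb)
  have h2 := hasSum_tt_mul hp0 hp a2 hp0 hp b3
  have h3 := (hasSum_tt_mul hp0 hp a3 hp0 hp b4).mul_left (-(a * b))
  rw [← parityEquiv.hasSum_iff] at h1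
  have h4 : HasSum ((fun x : ℤ × ℤ => tt r (a * b) x.1 * tt r (a / b) x.2) ∘ parityEquiv)
      (Th (r ^ 2) (-a ^ 2) * Th (r ^ 2) (-(r ^ 2 * b ^ 2)) + 
      -(a * b) * (Th (r ^ 2) (-(r ^ 2 * a ^ 2)) * Th (r ^ 2) (-((r ^ 2) ^ 2 * b ^ 2)))) := by
    have hz : ∀ (x : ℂ) (n : ℤ), (x ^ 2) ^ n = x ^ (2 * n) := by
      intro x n; rw [zpow_mul]; norm_cast
    have hn : ∀ (x : ℂ) (n : ℤ), (-x) ^ n = (-1) ^ n * x ^ n := by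
      intro x n; rw [← mul_zpow]; simp
    have hs : ∀ (n : ℤ), ((-1 : ℂ)) ^ n * (-1) ^ n = 1 := by
      intro n; rw [← mul_zpow]; simp
    apply HasSum.sum
    · refine hasSum_congr_fun ?_ h2
      rintro ⟨k, l⟩
      simp only [Function.comp, parityEquiv_inl, tt]
      rw [hn (a ^ 2), hn (r ^ 2 * b ^ 2), mul_zpow, mul_zpow, div_zpow, hz, hz, hz, hz, hz]
      have e : r ^ ((k + l) ^ 2 - (k + l)) * r ^ ((k - l) ^ 2 - (k - l)) =
        r ^ (2 * (k ^ 2 - k)) * r ^ (2 * (l ^ 2 - l)) * r ^ (2 * l) := by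
        simp only [← zpow_add₀ hr0]; congr 1; ring
      have e1 : a ^ (k + l) * a ^ (k - l) = a ^ (2 * k) := by
        simp only [← zpow_add₀ ha]; congr 1; ring
      have e2 : b ^ (k + l) / b ^ (k - l) = b ^ (2 * l) := by
        simp only [← zpow_sub₀ hb]; congr 1; ring
      have e3 : (-1 : ℂ) ^ (k + l) * (-1) ^ (k - l) = 1 := by
        rw [← zpow_add₀ (by norm_num)]
        have : k + l + (k - l) = 2 * k := by ring
        rw [this, neg_one_zpow_even]
      calc _ = ((-1 : ℂ) ^ (k + l) * (-1) ^ (k - l)) * 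
          (r ^ ((k + l) ^ 2 - (k + l)) * r ^ ((k - l) ^ 2 - (k - l))) * (a ^ (k + l) * a ^ (k - l)) *
          (b ^ (k + l) / b ^ (k - l)) := by ring
        _ = ((-1) ^ k * (-1) ^ k) * ((-1) ^ l * (-1) ^ l) *
          (r ^ (2 * (k ^ 2 - k)) * r ^ (2 * (l ^ 2 - l)) * r ^ (2 * l)) * a ^ (2 * k) * b ^ (2 * l) := by
            rw [e, e1, e2, e3, hs, hs]; ring
        _ = _ := by ring
    · refine hasSum_congr_fun ?_ h3
      rintro ⟨k, l⟩
      simp only [Function.comp, parityEquiv_inr, tt]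
      rw [hn (r ^ 2 * a ^ 2), hn ((r ^ 2) ^ 2 * b ^ 2), mul_zpow, mul_zpow, mul_zpow, div_zpow, hz, hz, hz, hz, hz,
        hz, hz]
      have e : r ^ ((k + l + 1) ^ 2 - (k + l + 1)) * r ^ ((k - l) ^ 2 - (k - l)) =
        r ^ (2 * (k ^ 2 - k)) * r ^ (2 * k) * r ^ (2 * (l ^ 2 - l)) * r ^ (2 * (2 * l)) := by
        simp only [← zpow_add₀ hr0]; congr 1; ring
      have e1 : a ^ (k + l + 1) * a ^ (k - l) = a ^ (2 * k) * a := by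
        rw [← zpow_add₀ ha, ← zpow_add_one₀ ha]; congr 1; ring
      have e2 : b ^ (k + l + 1) / b ^ (k - l) = b ^ (2 * l) * b := by
        rw [← zpow_sub₀ hb, ← zpow_add_one₀ hb]; congr 1; ring
      have e3 : (-1 : ℂ) ^ (k + l + 1) * (-1) ^ (k - l) = -1 := by
        rw [← zpow_add₀ (by norm_num)]
        have : k + l + 1 + (k - l) = 2 * k + 1 := by ring
        rw [this, zpow_add_one₀ (by norm_num), neg_one_zpow_even]; norm_num
      calc _ = ((-1 : ℂ) ^ (k + l + 1) * (-1) ^ (k - l)) * 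
          (r ^ ((k + l + 1) ^ 2 - (k + l + 1)) * r ^ ((k - l) ^ 2 - (k - l))) *
          (a ^ (k + l + 1) * a ^ (k - l)) *
          (b ^ (k + l + 1) / b ^ (k - l)) := by ring
        _ = -((-1) ^ k * (-1) ^ k) * ((-1) ^ l * (-1) ^ l) *
          (r ^ (2 * (k ^ 2 - k)) * r ^ (2 * k) * r ^ (2 * (l ^ 2 - l)) * r ^ (2 * (2 * l))) *
            (a ^ (2 * k) * a) * (b ^ (2 * l) * b) := by
            rw [e, e1, e2, e3, hs, hs]; ring
        _ = _ := by ring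
  have h5 := h1.unique h4
  have h6 := Th_shift (r := r ^ 2) (a := -b ^ 2) hp0 (neg_ne_zero.mpr (pow_ne_zero _ hb))
  have e : (r ^ 2) ^ 2 * -b ^ 2 = -((r ^ 2) ^ 2 * b ^ 2) := by ring
  rw [e] at h6
  rw [h5]
  linear_combination (a * Th (r ^ 2) (-(r ^ 2 * a ^ 2))) * h6

lemma three_term {r a c b : ℂ} (hr0 : r ≠ 0) (hr : ‖r‖ < 1) (ha : a ≠ 0) (hc : c ≠ 0) (hb : b ≠ 0) :
    (c * (Th r (a * c) * Th r (a / c))) * Th r b ^ 2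
      - (b * (Th r (a * b) * Th r (a / b))) * Th r c ^ 2
      + Th r a ^ 2 * (b * (Th r (c * b) * Th r (c / b))) = 0 := by
  have h1 := double_sum hr0 hr ha hc
  have h2 := double_sum hr0 hr ha hb
  have h3 := double_sum hr0 hr hc hb
  have k1 := double_sum hr0 hr ha one_ne_zero
  have k2 := double_sum hr0 hr hb one_ne_zero
  have k3 := double_sum hr0 hr hc one_ne_zero
  simp only [mul_one, div_one, one_mul] at k1 k2 k3
  simp only [pow_two (Th _ _)]
  rw [h1, h2, h3, k1, k2, k3]
  ring

end RF

namespace RF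
open Filter Topology

section expansion
variable {ι : Type*}

lemma fin_exp0 (t : Finset ι) (g : ι → ℂ) :
    ‖∏ i ∈ t, (1 + g i)‖ ≤ Real.exp (∑ i ∈ t, ‖g i‖) := by
  rw [norm_prod, Real.exp_sum]
  refine prod_le_prod (fun i _ => norm_nonneg _) fun i _ => ?_
  calc ‖1 + g i‖ ≤ ‖(1 : ℂ)‖ + ‖g i‖ := norm_add_le _ _
    _ = ‖g i‖ + 1 := by rw [norm_one]; ring
    _ ≤ _ := Real.add_one_le_exp _

lemma fin_exp [DecidableEq ι] (t : Finset ι) (g : ι → ℂ) :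
    ‖∏ i ∈ t, (1 + g i) - 1‖ ≤ (∑ i ∈ t, ‖g i‖) * Real.exp (∑ i ∈ t, ‖g i‖) ∧
    ‖∏ i ∈ t, (1 + g i) - 1 - ∑ i ∈ t, g i‖ ≤
      (∑ i ∈ t, ‖g i‖) ^ 2 * Real.exp (∑ i ∈ t, ‖g i‖) ∧
    ‖∏ i ∈ t, (1 + g i) - 1 - ∑ i ∈ t, g i - ((∑ i ∈ t, g i) ^ 2 - ∑ i ∈ t, g i ^ 2) / 2‖ ≤
      (∑ i ∈ t, ‖g i‖) ^ 3 * Real.exp (∑ i ∈ t, ‖g i‖) := by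
  induction t using Finset.induction_on with
  | empty => simp
  | insert j t hj ih =>
    obtain ⟨h1, h2, h3⟩ := ih
    have h0 := fin_exp0 t g
    rw [prod_insert hj, sum_insert hj, sum_insert hj, sum_insert hj]
    have hM : 0 ≤ ∑ i ∈ t, ‖g i‖ := sum_nonneg fun i _ => norm_nonneg _
    have hx : 0 ≤ ‖g j‖ := norm_nonneg _
    set M := ∑ i ∈ t, ‖g i‖
    set x := ‖g j‖ with hxx
    set Q := ∏ i ∈ t, (1 + g i)
    set e1 := ∑ i ∈ t, g i
    set e2 := ∑ i ∈ t, g i ^ 2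
    have hexp : Real.exp M ≤ Real.exp (x + M) := Real.exp_le_exp.mpr (by linarith)
    have hep : 0 < Real.exp M := Real.exp_pos _
    refine ⟨?_, ?_, ?_⟩
    · calc ‖(1 + g j) * Q - 1‖ = ‖(Q - 1) + g j * Q‖ := by ring_nf
        _ ≤ ‖Q - 1‖ + x * ‖Q‖ := (norm_add_le _ _).trans (by rw [norm_mul])
        _ ≤ M * Real.exp M + x * Real.exp M := by gcongr
        _ = (x + M) * Real.exp M := by ring
        _ ≤ _ := by gcongr
    · calc ‖(1 + g j) * Q - 1 - (g j + e1)‖ = ‖(Q - 1 - e1) + g j * (Q - 1)‖ := by ring_nf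
        _ ≤ ‖Q - 1 - e1‖ + x * ‖Q - 1‖ := (norm_add_le _ _).trans (by rw [norm_mul])
        _ ≤ M ^ 2 * Real.exp M + x * (M * Real.exp M) := by gcongr
        _ = (M ^ 2 + x * M) * Real.exp M := by ring
        _ ≤ (x + M) ^ 2 * Real.exp M := by
          gcongr; nlinarith [mul_nonneg hx hM, mul_nonneg hx hx]
        _ ≤ _ := by gcongr
    · calc ‖(1 + g j) * Q - 1 - (g j + e1) - ((g j + e1) ^ 2 - (g j ^ 2 + e2)) / 2‖
          = ‖(Q - 1 - e1 - (e1 ^ 2 - e2) / 2) + g j * (Q - 1 - e1)‖ := by ring_nf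
        _ ≤ ‖Q - 1 - e1 - (e1 ^ 2 - e2) / 2‖ + x * ‖Q - 1 - e1‖ :=
            (norm_add_le _ _).trans (by rw [norm_mul])
        _ ≤ M ^ 3 * Real.exp M + x * (M ^ 2 * Real.exp M) := by gcongr
        _ = (M ^ 3 + x * M ^ 2) * Real.exp M := by ring
        _ ≤ (x + M) ^ 3 * Real.exp M := by
          gcongr
          have : (x + M) ^ 3 = M ^ 3 + x * M ^ 2 + (2 * x * M ^ 2 + 3 * x ^ 2 * M + x ^ 3) := by ring
          rw [this]
          have : 0 ≤ 2 * x * M ^ 2 + 3 * x ^ 2 * M + x ^ 3 := by positivity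
          linarith
        _ ≤ _ := by gcongr

lemma summable_sq {f : ι → ℂ} (hf : Summable fun i => ‖f i‖) : Summable fun i => ‖f i ^ 2‖ := by
  have h1 := hf.tendsto_cofinite_zero.eventually (gt_mem_nhds (zero_lt_one' ℝ))
  refine Summable.of_norm_bounded_eventually hf ?_
  filter_upwards [h1] with i hi
  rw [norm_norm, norm_pow]
  nlinarith [norm_nonneg (f i)]

lemma tprod_exp [DecidableEq ι] {f : ι → ℂ} (hf : Summable fun i => ‖f i‖) :
    ∃ C, ∀ s : ℂ, ‖s‖ ≤ 1 →
      ‖∏' i, (1 - s * f i) - 1 + s * ∑' i, f i‖ ≤ C * ‖s‖ ^ 2 ∧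
      ‖∏' i, (1 - s * f i) - 1 + s * ∑' i, f i
        - s ^ 2 * ((∑' i, f i) ^ 2 - ∑' i, f i ^ 2) / 2‖ ≤ C * ‖s‖ ^ 3 := by
  set M := ∑' i, ‖f i‖ with hMdef
  have hM : 0 ≤ M := tsum_nonneg fun i => norm_nonneg _
  refine ⟨(M ^ 2 + M ^ 3) * Real.exp M, fun s hs => ?_⟩
  have hsum : Summable fun i => ‖-(s * f i)‖ := by
    simpa [norm_mul] using hf.mul_left ‖s‖
  have hP : Tendsto (fun t : Finset ι => ∏ i ∈ t, (1 + -(s * f i))) atTop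
      (𝓝 (∏' i, (1 - s * f i))) := by
    have := (multipliable_one_add_of_summable hsum).hasProd
    simp only [← sub_eq_add_neg] at this ⊢
    exact this
  have h1 : Tendsto (fun t : Finset ι => ∑ i ∈ t, -(s * f i)) atTop (𝓝 (-(s * ∑' i, f i))) :=
    (hf.of_norm.hasSum.mul_left s).neg
  have h2 : Tendsto (fun t : Finset ι => ∑ i ∈ t, (-(s * f i)) ^ 2) atTop
      (𝓝 (s ^ 2 * ∑' i, f i ^ 2)) := by
    have := ((summable_sq hf).of_norm.hasSum.mul_left (s ^ 2))
    refine this.congr fun t => ?_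
    refine sum_congr rfl fun i _ => ?_
    ring
  have hb : ∀ t : Finset ι, ∑ i ∈ t, ‖-(s * f i)‖ ≤ ‖s‖ * M := by
    intro t
    simp only [norm_neg, norm_mul, ← mul_sum]
    gcongr
    exact hf.sum_le_tsum t fun i _ => norm_nonneg _
  have hn : ∀ t : Finset ι, 0 ≤ ∑ i ∈ t, ‖-(s * f i)‖ := fun t => sum_nonneg fun i _ => norm_nonneg _
  have hsM : ‖s‖ * M ≤ M := by nlinarith
  constructor
  · have : Tendsto (fun t : Finset ι => ‖∏ i ∈ t, (1 + -(s * f i)) - 1 - ∑ i ∈ t, -(s * f i)‖) atTop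
      (𝓝 ‖∏' i, (1 - s * f i) - 1 - -(s * ∑' i, f i)‖) := ((hP.sub_const 1).sub h1).norm
    rw [sub_neg_eq_add] at this
    refine le_of_tendsto this (Eventually.of_forall fun t => ?_)
    refine (fin_exp t _).2.1.trans ?_
    have hn := hn t
    have hb := hb t
    calc _ ≤ (‖s‖ * M) ^ 2 * Real.exp M := by gcongr; exact hb.trans hsM
      _ = M ^ 2 * Real.exp M * ‖s‖ ^ 2 := by ring
      _ ≤ _ := by gcongr; have : 0 ≤ M ^ 3 := by positivity
                  linarith
  · have := (((hP.sub_const 1).sub h1).sub (((h1.pow 2).sub h2).div_const 2)).norm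
    have e : ∏' i, (1 - s * f i) - 1 - -(s * ∑' i, f i) -
        ((-(s * ∑' i, f i)) ^ 2 - s ^ 2 * ∑' i, f i ^ 2) / 2 = ∏' i, (1 - s * f i) - 1 + s * ∑' i, f i
        - s ^ 2 * ((∑' i, f i) ^ 2 - ∑' i, f i ^ 2) / 2 := by ring
    rw [e] at this
    refine le_of_tendsto this (Eventually.of_forall fun t => ?_)
    refine (fin_exp t _).2.2.trans ?_
    have hn := hn t
    have hb := hb t
    calc _ ≤ (‖s‖ * M) ^ 3 * Real.exp M := by gcongr; exact hb.trans hsM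
      _ = M ^ 3 * Real.exp M * ‖s‖ ^ 3 := by ring
      _ ≤ _ := by gcongr; have : 0 ≤ M ^ 2 := by positivity
                  linarith

lemma lin_zero {α C : ℂ} {D : ℝ} (h : ∀ s : ℂ, ‖s‖ ≤ 1 → ‖α * s + C * s ^ 2‖ ≤ D * ‖s‖ ^ 3) :
    α = 0 ∧ C = 0 := by
  have key : ∀ (β : ℂ) (B : ℝ), (∀ x : ℝ, 0 < x → x ≤ 1 → ‖β‖ ≤ B * x) → β = 0 := by
    intro β B hb
    have h1 : Tendsto (fun x : ℝ => B * x) (𝓝[>] 0) (𝓝 (B * 0)) :=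
      ((continuous_const.mul continuous_id).tendsto 0).mono_left nhdsWithin_le_nhds
    have h2 : ‖β‖ ≤ B * 0 := by
      refine ge_of_tendsto h1 ?_
      filter_upwards [Ioc_mem_nhdsGT (zero_lt_one' ℝ)] with x hx
      exact hb x hx.1 hx.2
    simpa using h2
  have ha : α = 0 := by
    apply key α (|D| + ‖C‖)
    intro x hx hx1
    have h1 := h x (by simpa [abs_of_pos hx] using hx1)
    rw [norm_real, Real.norm_of_nonneg hx.le] at h1
    have h2 : ‖α * x‖ ≤ ‖α * (x : ℂ) + C * (x : ℂ) ^ 2‖ + ‖C * (x : ℂ) ^ 2‖ := by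
      have := norm_sub_le (α * (x : ℂ) + C * (x : ℂ) ^ 2) (C * (x : ℂ) ^ 2)
      simpa using this
    rw [norm_mul, norm_mul, norm_pow, norm_real, Real.norm_of_nonneg hx.le] at h2
    have h3 : D * x ^ 3 ≤ |D| * x ^ 2 := by
      calc D * x ^ 3 ≤ |D| * x ^ 3 := by gcongr; exact le_abs_self D
        _ ≤ |D| * x ^ 2 := by gcongr ?_ * ?_; exact pow_le_pow_of_le_one hx.le hx1 (by norm_num)
    have h4 : ‖α‖ * x ≤ ((|D| + ‖C‖) * x) * x := by nlinarith
    exact le_of_mul_le_mul_right h4 hx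
  refine ⟨ha, ?_⟩
  apply key C D
  intro x hx hx1
  have h1 := h x (by simpa [abs_of_pos hx] using hx1)
  rw [ha, zero_mul, zero_add, norm_mul, norm_pow, norm_real, Real.norm_of_nonneg hx.le] at h1
  have h4 : ‖C‖ * x ^ 2 ≤ (D * x) * x ^ 2 := by nlinarith
  exact le_of_mul_le_mul_right h4 (by positivity)

end expansion

/-- `h(x) = x/(1-x)^2` -/
noncomputable def hh (x : ℂ) : ℂ := x / (1 - x) ^ 2

lemma summable_hh (x : ℂ) {p : ℂ} (hp : ‖p‖ < 1) : Summable fun n : ℕ => ‖hh (x * p ^ n)‖ := by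
  have h0 : Tendsto (fun n : ℕ => x * p ^ n) atTop (𝓝 0) := by
    simpa using (tendsto_pow_atTop_nhds_zero_of_norm_lt_one hp).const_mul x
  have h1 : Tendsto (fun n : ℕ => ((1 - x * p ^ n) ^ 2)⁻¹) atTop (𝓝 ((1 - 0) ^ 2)⁻¹) :=
    ((h0.const_sub 1).pow 2).inv₀ (by norm_num)
  obtain ⟨C, hC0, hC⟩ := bdd_of_tendsto h1
  refine Summable.of_nonneg_of_le (fun n => norm_nonneg _) (fun n => ?_)
    ((summable_geo x hp).mul_right C)
  rw [hh, div_eq_mul_inv, norm_mul]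
  gcongr
  exact hC n

/-- two-sided family of h-values -/
noncomputable def D (x y p : ℂ) : ℕ ⊕ ℕ → ℂ :=
  Sum.elim (fun n => hh (x * p ^ n)) (fun n => hh (y * p ^ n))

lemma summable_D (x y : ℂ) {p : ℂ} (hp : ‖p‖ < 1) : Summable fun i => ‖D x y p i‖ := by
  exact (HasSum.sum (f := fun i => ‖D x y p i‖) (summable_hh x hp).hasSum (summable_hh y hp).hasSum).summable

end RF

namespace RF
open Filter Topology

lemma tsum_D (x y : ℂ) {p : ℂ} (hp : ‖p‖ < 1) :
    ∑' i, D x y p i = ∑' n : ℕ, hh (x * p ^ n) + ∑' n : ℕ, hh (y * p ^ n) :=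
  (HasSum.sum (f := fun i => D x y p i) (summable_hh x hp).of_norm.hasSum
    (summable_hh y hp).of_norm.hasSum).tsum_eq

lemma tsum_D2 (x y : ℂ) {p : ℂ} (hp : ‖p‖ < 1) :
    ∑' i, D x y p i ^ 2 = ∑' n : ℕ, hh (x * p ^ n) ^ 2 + ∑' n : ℕ, hh (y * p ^ n) ^ 2 :=
  (HasSum.sum (f := fun i => D x y p i ^ 2) (summable_sq (summable_hh x hp)).of_norm.hasSum
    (summable_sq (summable_hh y hp)).of_norm.hasSum).tsum_eq

lemma mult_hh (x s : ℂ) {p : ℂ} (hp : ‖p‖ < 1) :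
    Multipliable fun n : ℕ => (1 - s * hh (x * p ^ n)) := by
  simp only [sub_eq_add_neg]
  apply multipliable_one_add_of_summable
  simpa using (summable_hh x hp).mul_left ‖s‖

lemma tprod_D (x y s : ℂ) {p : ℂ} (hp : ‖p‖ < 1) :
    ∏' i, (1 - s * D x y p i) = (∏' n : ℕ, (1 - s * hh (x * p ^ n))) * ∏' n : ℕ, (1 - s * hh (y * p ^ n)) :=
  (HasProd.sum (f := fun i => (1 - s * D x y p i)) (mult_hh x s hp).hasProd
    (mult_hh y s hp).hasProd).tprod_eq

/-- `x p^n` avoids 1 -/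
def good (x p : ℂ) : Prop := ∀ n : ℕ, x * p ^ n ≠ 1

lemma P_pair {x p b : ℂ} (hp : ‖p‖ < 1) (hx : good x p) (hb : b ≠ 0) :
    P (x * b) p * P (x / b) p = P x p ^ 2 * ∏' n : ℕ, (1 - (b + 1 / b - 2) * hh (x * p ^ n)) := by
  unfold P
  rw [← (P_mult (x * b) hp).tprod_mul (P_mult (x / b) hp), pow_two,
    ← (P_mult x hp).tprod_mul (P_mult x hp),
    ← ((P_mult x hp).mul (P_mult x hp)).tprod_mul (mult_hh x _ hp)]
  refine tprod_congr fun n => ?_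
  have := sub_ne_zero.mpr (hx n).symm
  rw [hh]
  have e1 : x * b * p ^ n = (x * p ^ n) * b := by ring
  have e2 : x / b * p ^ n = (x * p ^ n) / b := by ring
  rw [e1, e2]
  generalize x * p ^ n = y at *
  field_simp
  ring

lemma exists_b (s : ℂ) : ∃ b : ℂ, b ≠ 0 ∧ b + 1 / b - 2 = s := by
  obtain ⟨d, hd⟩ := IsAlgClosed.exists_pow_nat_eq ((s + 2) ^ 2 - 4) (n := 2) two_pos
  have h : ((s + 2 + d) / 2) * ((s + 2 - d) / 2) = 1 := by
    linear_combination -(1 / 4) * hd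
  have h0 : (s + 2 + d) / 2 ≠ 0 := left_ne_zero_of_mul_eq_one h
  refine ⟨(s + 2 + d) / 2, h0, ?_⟩
  rw [← h, mul_div_cancel_left₀ _ h0]
  ring

lemma good_p {p : ℂ} (hp : ‖p‖ < 1) : good p p := by
  intro n
  rw [← pow_succ']
  exact pow_ne_one_of_norm hp (by omega)

/-- the constant κ -/
noncomputable def kap (r a c : ℂ) : ℂ :=
  c * (Th r (a * c) * Th r (a / c)) * E (r ^ 2) ^ 6 / (Th r a ^ 2 * Th r c ^ 2)

lemma Th_ne {r a : ℂ} (hr0 : r ≠ 0) (hr : ‖r‖ < 1) (ha : a ≠ 0)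
    (g1 : good a (r ^ 2)) (g2 : good (r ^ 2 / a) (r ^ 2)) : Th r a ≠ 0 := by
  have hp := norm_pow_lt hr two_ne_zero
  rw [jtp hr0 hr ha]
  exact mul_ne_zero (mul_ne_zero (E_ne_zero hp) (P_ne_zero hp g1)) (P_ne_zero hp g2)

lemma Th_pair {r a b : ℂ} (hr0 : r ≠ 0) (hr : ‖r‖ < 1) (ha : a ≠ 0) (hb : b ≠ 0)
    (g1 : good a (r ^ 2)) (g2 : good (r ^ 2 / a) (r ^ 2)) :
    Th r (a * b) * Th r (a / b) =
      Th r a ^ 2 * ∏' i, (1 - (b + 1 / b - 2) * D a (r ^ 2 / a) (r ^ 2) i) := by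
  have hp := norm_pow_lt hr two_ne_zero
  rw [jtp hr0 hr ha, jtp hr0 hr (mul_ne_zero ha hb), jtp hr0 hr (div_ne_zero ha hb), tprod_D _ _ _ hp]
  have h1 := P_pair hp g1 hb
  have h2 := P_pair hp g2 hb
  have e1 : r ^ 2 / (a * b) = r ^ 2 / a / b := by field_simp
  have e2 : r ^ 2 / (a / b) = r ^ 2 / a * b := by field_simp
  rw [e1, e2]
  calc _ = E (r ^ 2) ^ 2 * (P (a * b) (r ^ 2) * P (a / b) (r ^ 2)) * 
      (P (r ^ 2 / a * b) (r ^ 2) * P (r ^ 2 / a / b) (r ^ 2)) := by ring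
    _ = _ := by rw [h1, h2]; ring

lemma Th_sq {r b : ℂ} (hr0 : r ≠ 0) (hr : ‖r‖ < 1) (hb : b ≠ 0) :
    Th r b ^ 2 = b * ((b + 1 / b - 2) * E (r ^ 2) ^ 6 *
      ∏' i, (1 - (b + 1 / b - 2) * D (r ^ 2) (r ^ 2) (r ^ 2) i)) := by
  have hp := norm_pow_lt hr two_ne_zero
  have h1 := P_pair hp (good_p hp) hb
  rw [jtp hr0 hr hb, tprod_D _ _ _ hp, P_succ b hp, mul_comm b (r ^ 2)]
  have e : E (r ^ 2) = P (r ^ 2) (r ^ 2) := rfl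
  rw [← e] at h1
  have e2 : b * (b + 1 / b - 2) = (1 - b) ^ 2 := by field_simp; ring
  calc _ = E (r ^ 2) ^ 2 * (1 - b) ^ 2 * (P (r ^ 2 * b) (r ^ 2) * P (r ^ 2 / b) (r ^ 2)) ^ 2 := by ring
    _ = _ := by rw [h1, ← e2]; ring

lemma F_diff {r a c : ℂ} (hr0 : r ≠ 0) (hr : ‖r‖ < 1) (ha : a ≠ 0) (hc : c ≠ 0)
    (g1 : good a (r ^ 2)) (g2 : good (r ^ 2 / a) (r ^ 2))
    (g3 : good c (r ^ 2)) (g4 : good (r ^ 2 / c) (r ^ 2)) (s : ℂ) :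
    ∏' i, (1 - s * D a (r ^ 2 / a) (r ^ 2) i) - ∏' i, (1 - s * D c (r ^ 2 / c) (r ^ 2) i) =
      kap r a c * s * ∏' i, (1 - s * D (r ^ 2) (r ^ 2) (r ^ 2) i) := by
  obtain ⟨b, hb, rfl⟩ := exists_b s
  have h := three_term hr0 hr ha hc hb
  have ta := Th_ne hr0 hr ha g1 g2
  have tc := Th_ne hr0 hr hc g3 g4
  rw [Th_pair hr0 hr ha hb g1 g2, Th_pair hr0 hr hc hb g3 g4, Th_sq hr0 hr hb] at h
  unfold kap
  generalize ∏' i, (1 - (b + 1 / b - 2) * D a (r ^ 2 / a) (r ^ 2) i) = X at *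
  generalize ∏' i, (1 - (b + 1 / b - 2) * D c (r ^ 2 / c) (r ^ 2) i) = Y at *
  generalize ∏' i, (1 - (b + 1 / b - 2) * D (r ^ 2) (r ^ 2) (r ^ 2) i) = Z at *
  generalize b + 1 / b - 2 = s at *
  have hne : b * (Th r a ^ 2 * Th r c ^ 2) ≠ 0 := by positivity
  apply mul_left_cancel₀ hne
  have e : b * (Th r a ^ 2 * Th r c ^ 2) * (c * (Th r (a * c) * Th r (a / c)) * E (r ^ 2) ^ 6 / (Th r a ^ 2 * Th r c ^ 2) * s * Z) = b * (c * (Th r (a * c) * Th r (a / c)) * E (r ^ 2) ^ 6 * s * Z) := by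
    field_simp
  rw [e]
  linear_combination -h

/-- `Λ(a)` -/
noncomputable def Lam (a p : ℂ) : ℂ := ∑' n : ℕ, hh (a * p ^ n) + ∑' n : ℕ, hh (p / a * p ^ n)

/-- `Λ₂(a)` -/
noncomputable def Lam2 (a p : ℂ) : ℂ :=
  ∑' n : ℕ, hh (a * p ^ n) ^ 2 + ∑' n : ℕ, hh (p / a * p ^ n) ^ 2

/-- Lambert series of weight two -/
noncomputable def S (p : ℂ) : ℂ := ∑' n : ℕ, hh (p * p ^ n)

lemma G12 {r a c : ℂ} (hr0 : r ≠ 0) (hr : ‖r‖ < 1) (ha : a ≠ 0) (hc : c ≠ 0)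
    (g1 : good a (r ^ 2)) (g2 : good (r ^ 2 / a) (r ^ 2))
    (g3 : good c (r ^ 2)) (g4 : good (r ^ 2 / c) (r ^ 2)) :
    Lam c (r ^ 2) - Lam a (r ^ 2) = kap r a c ∧
    Lam2 a (r ^ 2) - Lam2 c (r ^ 2) = (Lam a (r ^ 2) - Lam c (r ^ 2)) *
      (Lam a (r ^ 2) + Lam c (r ^ 2) - 4 * S (r ^ 2)) := by
  classical
  have hp := norm_pow_lt hr two_ne_zero
  have hF := F_diff hr0 hr ha hc g1 g2 g3 g4
  generalize kap r a c = κ at *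
  obtain ⟨C1, h1⟩ := tprod_exp (summable_D a (r ^ 2 / a) hp)
  obtain ⟨C2, h2⟩ := tprod_exp (summable_D c (r ^ 2 / c) hp)
  obtain ⟨C3, h3⟩ := tprod_exp (summable_D (r ^ 2) (r ^ 2) hp)
  rw [tsum_D _ _ hp, tsum_D2 _ _ hp] at h1 h2
  rw [tsum_D _ _ hp] at h3
  change ∀ s : ℂ, ‖s‖ ≤ 1 → ‖_ - 1 + s * Lam a (r ^ 2)‖ ≤ _ ∧
    ‖_ - 1 + s * Lam a (r ^ 2) - s ^ 2 * (Lam a (r ^ 2) ^ 2 - Lam2 a (r ^ 2)) / 2‖ ≤ _ at h1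
  change ∀ s : ℂ, ‖s‖ ≤ 1 → ‖_ - 1 + s * Lam c (r ^ 2)‖ ≤ _ ∧
    ‖_ - 1 + s * Lam c (r ^ 2) - s ^ 2 * (Lam c (r ^ 2) ^ 2 - Lam2 c (r ^ 2)) / 2‖ ≤ _ at h2
  change ∀ s : ℂ, ‖s‖ ≤ 1 → ‖_ - 1 + s * (S (r ^ 2) + S (r ^ 2))‖ ≤ _ ∧ _ at h3
  generalize Lam a (r ^ 2) = A at *
  generalize Lam c (r ^ 2) = B at *
  generalize Lam2 a (r ^ 2) = A2 at *
  generalize Lam2 c (r ^ 2) = B2 at *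
  generalize S (r ^ 2) = T at *
  have key := lin_zero (α := B - A - κ)
    (C := (A ^ 2 - A2) / 2 - (B ^ 2 - B2) / 2 + κ * (2 * T)) (D := C1 + C2 + ‖κ‖ * C3) ?_
  · obtain ⟨k1, k2⟩ := key
    have k3 : κ = B - A := by linear_combination -k1
    subst k3
    exact ⟨rfl, by linear_combination -2 * k2⟩
  · intro s hs
    have H := hF s
    have h1 := (h1 s hs).2
    have h2 := (h2 s hs).2
    have h3 := (h3 s hs).1
    generalize ∏' i, (1 - s * D a (r ^ 2 / a) (r ^ 2) i) = X at *
    generalize ∏' i, (1 - s * D c (r ^ 2 / c) (r ^ 2) i) = Y at *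
    generalize ∏' i, (1 - s * D (r ^ 2) (r ^ 2) (r ^ 2) i) = Z at *
    set U := X - 1 + s * A - s ^ 2 * (A ^ 2 - A2) / 2 with hU
    set V := Y - 1 + s * B - s ^ 2 * (B ^ 2 - B2) / 2 with hV
    set W := Z - 1 + s * (T + T) with hW
    have e : (B - A - κ) * s + ((A ^ 2 - A2) / 2 - (B ^ 2 - B2) / 2 + κ * (2 * T)) * s ^ 2 =
        -U + V + κ * s * W := by
      rw [hU, hV, hW]; linear_combination H
    rw [e]
    calc ‖-U + V + κ * s * W‖ ≤ ‖U‖ + ‖V‖ + ‖κ‖ * ‖s‖ * ‖W‖ := by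
          refine (norm_add_le _ _).trans ?_
          rw [norm_mul, norm_mul]
          gcongr
          refine (norm_add_le _ _).trans ?_
          rw [norm_neg]
      _ ≤ C1 * ‖s‖ ^ 3 + C2 * ‖s‖ ^ 3 + ‖κ‖ * ‖s‖ * (C3 * ‖s‖ ^ 2) := by gcongr
      _ = _ := by ring

end RF

namespace RF
open Filter Topology

/-- `∑ h(x p^n)` -/
noncomputable def H (x p : ℂ) : ℂ := ∑' n : ℕ, hh (x * p ^ n)

lemma S_eq (p : ℂ) : S p = H p p := rfl

lemma Lam_eq (a p : ℂ) : Lam a p = H a p + H (p / a) p := rfl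

lemma tsum_dissect {f : ℕ → ℂ} (hf : Summable f) :
    ∑' n, f n = ∑' n, f (2 * n) + ∑' n, f (2 * n + 1) := by
  refine (tsum_even_add_odd ?_ ?_).symm
  · exact hf.comp_injective fun a b h => by simpa using h
  · exact hf.comp_injective fun a b h => by simpa using h

lemma H_dissect (x : ℂ) {p : ℂ} (hp : ‖p‖ < 1) : H x p = H x (p ^ 2) + H (x * p) (p ^ 2) := by
  unfold H
  rw [tsum_dissect (summable_hh x hp).of_norm]
  congr 2 <;> funext n <;> congr 1 <;> ring

lemma H_succ (x : ℂ) {p : ℂ} (hp : ‖p‖ < 1) : H x p = hh x + H (x * p) p := by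
  unfold H
  rw [(summable_hh x hp).of_norm.tsum_eq_zero_add]
  congr 1
  · simp
  · congr 1; funext n; congr 1; ring

lemma hh_pair {y : ℂ} (hy : y ^ 2 ≠ 1) : hh y + hh (-y) = 4 * hh (y ^ 2) := by
  have h1 : 1 - y ≠ 0 := by
    intro h; apply hy; have : y = 1 := by linear_combination -h
    rw [this]; norm_num
  have h2 : 1 + y ≠ 0 := by
    intro h; apply hy; have : y = -1 := by linear_combination h
    rw [this]; norm_num
  have h3 : 1 - y ^ 2 ≠ 0 := by
    have : 1 - y ^ 2 = (1 - y) * (1 + y) := by ring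
    rw [this]; exact mul_ne_zero h1 h2
  unfold hh
  rw [sub_neg_eq_add]
  have : 1 - y ^ 2 = (1 - y) * (1 + y) := by ring
  rw [this]
  field_simp
  ring

lemma H_pair {x p : ℂ} (hx : ‖x‖ < 1) (hp : ‖p‖ < 1) : H x p + H (-x) p = 4 * H (x ^ 2) (p ^ 2) := by
  unfold H
  rw [← (summable_hh x hp).of_norm.tsum_add (summable_hh (-x) hp).of_norm, ← tsum_mul_left]
  refine tsum_congr fun n => ?_
  have e1 : -x * p ^ n = -(x * p ^ n) := by ring
  have e2 : x ^ 2 * (p ^ 2) ^ n = (x * p ^ n) ^ 2 := by ring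
  rw [e1, e2, hh_pair]
  apply pow_ne_one_of_norm _ two_ne_zero
  rw [norm_mul, norm_pow]
  calc ‖x‖ * ‖p‖ ^ n ≤ ‖x‖ * 1 := by gcongr; exact pow_le_one₀ (norm_nonneg _) hp.le
    _ < 1 := by rwa [mul_one]

lemma S_odd {q : ℂ} (hq : ‖q‖ < 1) : H q (q ^ 2) = S q - S (q ^ 2) := by
  rw [S_eq, S_eq, H_dissect q hq]
  have : q * q = q ^ 2 := by ring
  rw [this]; ring

lemma S_neg {q : ℂ} (hq : ‖q‖ < 1) : S (-q) = - S q + 6 * S (q ^ 2) - 4 * S (q ^ 4) := by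
  have hq2 := norm_pow_lt hq two_ne_zero
  have hn : ‖-q‖ < 1 := by rwa [norm_neg]
  have h1 := S_odd hq
  have h2 := S_odd hq2
  have h3 := S_odd hn
  have h4 := H_pair hq hq2
  have e : (-q) ^ 2 = q ^ 2 := by ring
  have e2 : (q ^ 2) ^ 2 = q ^ 4 := by ring
  rw [e] at h3
  rw [e2] at h2 h4
  rw [h1, h2, h3] at h4
  linear_combination h4

/-- the theta constant in product form -/
noncomputable def ph (q : ℂ) : ℂ := E (q ^ 2) * P (-q) (q ^ 2) ^ 2

lemma ph_neg {q : ℂ} (hq : ‖q‖ < 1) : ph (-q) = E q ^ 2 / E (q ^ 2) := by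
  have := P_odd hq
  have h2 := E_ne_zero (norm_pow_lt hq two_ne_zero)
  unfold ph
  rw [neg_neg, neg_sq, ← this]
  field_simp

lemma P_neg_odd {q : ℂ} (hq : ‖q‖ < 1) :
    P (-q) (q ^ 2) = E (q ^ 2) ^ 2 / (E q * E (q ^ 4)) := by
  have hq2 := norm_pow_lt hq two_ne_zero
  have h0 := E_ne_zero hq
  have h2 := E_ne_zero hq2
  have h4 := E_ne_zero (norm_pow_lt hq four_ne_zero)
  have a1 := P_neg_self hq
  have a2 := P_neg_self hq2
  have a3 := P_dissect (-q) hq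
  have e : -q * q = -q ^ 2 := by ring
  have e2 : (q ^ 2) ^ 2 = q ^ 4 := by ring
  rw [e] at a3
  rw [e2] at a2
  rw [a3] at a1
  field_simp
  calc _ = P (-q) (q ^ 2) * E q * (E (q ^ 2) * P (-q ^ 2) (q ^ 2)) := by rw [a2, mul_assoc]
    _ = E (q ^ 2) * (E q * (P (-q) (q ^ 2) * P (-q ^ 2) (q ^ 2))) := by ring
    _ = _ := by rw [a1]; ring

lemma ph_eq {q : ℂ} (hq : ‖q‖ < 1) :
    ph q = E (q ^ 2) ^ 5 / (E q ^ 2 * E (q ^ 4) ^ 2) := by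
  unfold ph
  rw [P_neg_odd hq]
  ring

lemma P_neg_self' {q : ℂ} (hq : ‖q‖ < 1) : P (-q) q = E (q ^ 2) / E q := by
  rw [← P_neg_self hq, mul_div_cancel_left₀ _ (E_ne_zero hq)]

lemma good_of_norm_lt {x p : ℂ} (hx : ‖x‖ < 1) (hp : ‖p‖ < 1) : good x p := by
  intro n h
  have := congrArg norm h
  rw [norm_mul, norm_pow, norm_one] at this
  have : ‖x‖ * ‖p‖ ^ n ≤ ‖x‖ * 1 := by gcongr; exact pow_le_one₀ (norm_nonneg _) hp.le
  linarith

lemma good_unit {x p : ℂ} (hx : ‖x‖ = 1) (hx1 : x ≠ 1) (hp : ‖p‖ < 1) : good x p := by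
  intro n h
  rcases n with _ | n
  · exact hx1 (by simpa using h)
  · have := congrArg norm h
    rw [norm_mul, norm_pow, norm_one, hx, one_mul] at this
    have h2 := pow_lt_one₀ (norm_nonneg _) hp (Nat.succ_ne_zero n)
    exact absurd this h2.ne

lemma norm_I_pow {ζ : ℂ} (h : ζ ^ 8 = 1) : ‖ζ‖ = 1 := by
  have := congrArg norm h
  rw [norm_pow, norm_one] at this
  exact (pow_eq_one_iff_of_nonneg (norm_nonneg _) (by norm_num)).mp this

lemma norm_unit_mul {ζ p : ℂ} (h : ‖ζ‖ = 1) (hp : ‖p‖ < 1) : ‖ζ * p‖ < 1 := by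
  rwa [norm_mul, h, one_mul]

lemma norm_div_unit {ζ p : ℂ} (h : ‖ζ‖ = 1) (hp : ‖p‖ < 1) : ‖p / ζ‖ < 1 := by
  rwa [norm_div, h, div_one]

/-- Theta at `-1`. -/
lemma Th_neg_one {r : ℂ} (hr0 : r ≠ 0) (hr : ‖r‖ < 1) :
    Th r (-1) = 2 * E (r ^ 4) ^ 2 / E (r ^ 2) := by
  have hp := norm_pow_lt hr two_ne_zero
  have h0 := E_ne_zero hp
  rw [jtp hr0 hr (by norm_num), P_succ (-1) hp]
  have e : -1 * r ^ 2 = -(r ^ 2) := by ring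
  have e2 : r ^ 2 / -1 = -(r ^ 2) := by ring
  have e3 : (r ^ 2) ^ 2 = r ^ 4 := by ring
  rw [e, e2, P_neg_self' hp, e3]
  field_simp
  ring

/-- Theta at a primitive fourth root of unity. -/
lemma Th_I {r i : ℂ} (hr0 : r ≠ 0) (hr : ‖r‖ < 1) (hi : i ^ 2 = -1) :
    Th r i = E (r ^ 2) * (1 - i) * (E (r ^ 8) / E (r ^ 4)) := by
  have hp := norm_pow_lt hr two_ne_zero
  have hp4 := norm_pow_lt hr four_ne_zero
  have i0 : i ≠ 0 := by rintro rfl; norm_num at hi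
  rw [jtp hr0 hr i0, P_succ i hp]
  have e : r ^ 2 / i = -(i * r ^ 2) := by
    field_simp; linear_combination hi
  have h := P_neg_mul (i * r ^ 2) hp
  have e2 : (i * r ^ 2) ^ 2 = -(r ^ 4) := by linear_combination r ^ 4 * hi
  have e3 : (r ^ 2) ^ 2 = r ^ 4 := by ring
  have e4 : (r ^ 4) ^ 2 = r ^ 8 := by ring
  rw [e2, e3, P_neg_self' hp4, e4] at h
  rw [e, ← h]
  ring

/-- Jacobi four squares in Lambert form, for `-q`. -/
lemma four_sq_neg {q : ℂ} (hq0 : q ≠ 0) (hq : ‖q‖ < 1) :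
    ph (-q) ^ 4 = 1 - 8 * S q + 48 * S (q ^ 2) - 64 * S (q ^ 4) := by
  obtain ⟨r, hr⟩ := IsAlgClosed.exists_pow_nat_eq q (n := 2) two_pos
  have hr0 : r ≠ 0 := by rintro rfl; apply hq0; rw [← hr]; norm_num
  have hr1 : ‖r‖ < 1 := by
    rw [← hr, norm_pow] at hq
    exact (pow_lt_one_iff_of_nonneg (norm_nonneg _) two_ne_zero).mp hq
  have hq2 := norm_pow_lt hq two_ne_zero
  have hI : (I : ℂ) ^ 2 = -1 := I_sq
  have nI : ‖I‖ = 1 := by simp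
  have I1 : (I : ℂ) ≠ 1 := by
    intro h; rw [h] at hI; norm_num at hI
  have n1 : ‖(-1 : ℂ)‖ = 1 := by simp
  have h := (G12 (a := -1) (c := I) hr0 hr1 (by norm_num) I_ne_zero
    (by rw [hr]; exact good_unit n1 (by norm_num) hq) (by rw [hr]; exact good_of_norm_lt (norm_div_unit n1 hq) hq)
    (by rw [hr]; exact good_unit nI I1 hq) (by rw [hr]; exact good_of_norm_lt (norm_div_unit nI hq) hq)).1
  have e1 : (-1 : ℂ) * I = -I := by ring
  have e2 : (-1 : ℂ) / I = I := by simp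
  have hI' : (-I : ℂ) ^ 2 = -1 := by rw [neg_sq]; exact hI
  unfold kap at h
  rw [e1, e2, Th_neg_one hr0 hr1, Th_I hr0 hr1 hI, Th_I hr0 hr1 hI'] at h
  have r4 : r ^ 4 = q ^ 2 := by rw [← hr]; ring
  have r8 : r ^ 8 = q ^ 4 := by rw [← hr]; ring
  rw [hr, r4, r8] at h
  have E1 := E_ne_zero hq
  have E2 := E_ne_zero hq2
  have E4 := E_ne_zero (norm_pow_lt hq four_ne_zero)
  have l1 : Lam I q = -1 / 2 + 16 * S (q ^ 4) - 4 * S (q ^ 2) := by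
    rw [Lam_eq, H_succ _ hq]
    have e3 : q / I = -(I * q) := by simp [mul_comm]
    have h5 := H_pair (norm_unit_mul nI hq) hq
    have h6 := H_pair hq2 hq2
    have e4 : (I * q) ^ 2 = -q ^ 2 := by rw [mul_pow, hI]; ring
    have e5 : (q ^ 2) ^ 2 = q ^ 4 := by ring
    rw [e4] at h5
    rw [e5] at h6
    have e6 : hh I = -1 / 2 := by
      unfold hh
      have : (1 - I) ^ 2 = -2 * I := by linear_combination hI
      rw [this]; field_simp
    rw [e3, e6, S_eq, S_eq]
    linear_combination h5 + 4 * h6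
  have l2 : Lam (-1) q = -1 / 4 + 8 * S (q ^ 2) - 2 * S q := by
    rw [Lam_eq, H_succ _ hq]
    have e3 : q / -1 = -q := by ring
    have e4 : -1 * q = -q := by ring
    have e5 : hh (-1) = -1 / 4 := by unfold hh; norm_num
    have h6 := H_pair hq hq
    rw [e3, e4, e5, S_eq, S_eq]
    linear_combination 2 * h6
  rw [l1, l2] at h
  rw [ph_neg hq]
  have key : I * (E q * (1 - -I) * (E (q ^ 4) / E (q ^ 2)) * (E q * (1 - I) * (E (q ^ 4) / E (q ^ 2)))) * E q ^ 6 /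
      ((2 * E (q ^ 2) ^ 2 / E q) ^ 2 * (E q * (1 - I) * (E (q ^ 4) / E (q ^ 2))) ^ 2) =
      -(1 / 4) * (E q ^ 2 / E (q ^ 2)) ^ 4 := by
    have n2 : (1 - I : ℂ) ≠ 0 := sub_ne_zero.mpr I1.symm
    field_simp
    linear_combination 4 * hI
  rw [key] at h
  linear_combination 4 * h

lemma four_sq {q : ℂ} (hq0 : q ≠ 0) (hq : ‖q‖ < 1) :
    ph q ^ 4 = 1 + 8 * S q - 32 * S (q ^ 4) := by
  have h := four_sq_neg (neg_ne_zero.mpr hq0) (by rwa [norm_neg] : ‖-q‖ < 1)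
  have e : (-q) ^ 2 = q ^ 2 := by ring
  have e4 : (-q) ^ 4 = q ^ 4 := by ring
  rw [neg_neg, e, e4, S_neg hq] at h
  rw [h]; ring

end RF

namespace RF
open Filter Topology

/-- `Λ₄` -/
noncomputable def Lam4 (a p : ℂ) : ℂ := Lam a p + 6 * Lam2 a p

lemma Lam4_diff {r a c : ℂ} (hr0 : r ≠ 0) (hr : ‖r‖ < 1) (ha : a ≠ 0) (hc : c ≠ 0)
    (g1 : good a (r ^ 2)) (g2 : good (r ^ 2 / a) (r ^ 2))
    (g3 : good c (r ^ 2)) (g4 : good (r ^ 2 / c) (r ^ 2)) :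
    Lam4 c (r ^ 2) - Lam4 a (r ^ 2) = kap r a c *
      (1 + 6 * (Lam c (r ^ 2) + Lam a (r ^ 2)) - 24 * S (r ^ 2)) := by
  obtain ⟨h1, h2⟩ := G12 hr0 hr ha hc g1 g2 g3 g4
  unfold Lam4
  rw [← h1]
  linear_combination -6 * h2

lemma spec1 {q : ℂ} (hq0 : q ≠ 0) (hq : ‖q‖ < 1) :
    Lam4 q (q ^ 8) - Lam4 (q ^ 3) (q ^ 8) =
      (q * E (q ^ 8) ^ 2 * E (q ^ 4) * E (q ^ 2) ^ 3 / E q ^ 2) *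
      (1 + 6 * S q - 6 * S (q ^ 2) - 24 * S (q ^ 8)) := by
  have n2 := norm_pow_lt hq two_ne_zero
  have n3 := norm_pow_lt hq three_ne_zero
  have n4 := norm_pow_lt hq four_ne_zero
  have n5 := norm_pow_lt hq (n := 5) (by norm_num)
  have n7 := norm_pow_lt hq (n := 7) (by norm_num)
  have n8 := norm_pow_lt hq (n := 8) (by norm_num)
  have q3 : q ^ 3 ≠ 0 := pow_ne_zero _ hq0
  have q4 : q ^ 4 ≠ 0 := pow_ne_zero _ hq0
  have d1 : q ^ 8 / q = q ^ 7 := by field_simp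
  have d3 : q ^ 8 / q ^ 3 = q ^ 5 := by field_simp
  have d4 : q ^ 8 / q ^ 4 = q ^ 4 := by field_simp
  have d2 : q ^ 8 / q ^ 2 = q ^ 6 := by field_simp
  have r8 : (q ^ 4) ^ 2 = q ^ 8 := by ring
  have h := Lam4_diff (r := q ^ 4) (a := q ^ 3) (c := q) q4 n4 q3 hq0
    (by rw [r8]; exact good_of_norm_lt n3 n8) (by rw [r8, d3]; exact good_of_norm_lt n5 n8)
    (by rw [r8]; exact good_of_norm_lt hq n8) (by rw [r8, d1]; exact good_of_norm_lt n7 n8)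
  rw [r8] at h
  rw [h]
  have E1 := E_ne_zero hq
  have E2 := E_ne_zero n2
  have E4 := E_ne_zero n4
  have E8 := E_ne_zero n8
  have o1 := P_odd hq
  have o2 := P_odd n2
  have o4 := P_odd n4
  have D1 := P_dissect q n2
  have D1' := P_dissect q n4
  have D1'' := P_dissect (q ^ 3) n4
  have D2 := P_dissect (q ^ 2) n4
  have e1 : q * q ^ 2 = q ^ 3 := by ring
  have e2 : (q ^ 2) ^ 2 = q ^ 4 := by ring
  have e3 : q * q ^ 4 = q ^ 5 := by ring
  have e4 : q ^ 3 * q ^ 4 = q ^ 7 := by ring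
  have e5 : q ^ 2 * q ^ 4 = q ^ 6 := by ring
  rw [e1, e2] at D1
  rw [e3, r8] at D1'
  rw [e4, r8] at D1''
  rw [e5, r8] at D2
  rw [e2] at o2
  rw [r8] at o4
  have t4 : Th (q ^ 4) (q ^ 3 * q) = E (q ^ 4) ^ 2 / E (q ^ 8) := by
    have e : q ^ 3 * q = q ^ 4 := by ring
    rw [jtp q4 n4 (by rw [e]; exact q4), r8, e, d4, ← o4]
    field_simp
  have t2 : Th (q ^ 4) (q ^ 3 / q) = E (q ^ 8) * E (q ^ 2) / E (q ^ 4) := by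
    have e : q ^ 3 / q = q ^ 2 := by field_simp
    rw [jtp q4 n4 (by rw [e]; exact pow_ne_zero _ hq0), r8, e, d2, ← o2, D2]
    field_simp
  have t13 : Th (q ^ 4) (q ^ 3) * Th (q ^ 4) q = E (q ^ 8) ^ 2 * E q / E (q ^ 2) := by
    rw [jtp q4 n4 q3, jtp q4 n4 hq0, r8, d1, d3, ← o1, D1, D1', D1'']
    field_simp
  have hk : kap (q ^ 4) (q ^ 3) q = q * E (q ^ 8) ^ 2 * E (q ^ 4) * E (q ^ 2) ^ 3 / E q ^ 2 := by
    unfold kap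
    rw [← mul_pow, t13, t4, t2, r8]
    field_simp
  have hl : Lam q (q ^ 8) + Lam (q ^ 3) (q ^ 8) = S q - S (q ^ 2) := by
    rw [← S_odd hq, H_dissect q n2, e1, e2, H_dissect q n4, H_dissect (q ^ 3) n4, e3, e4, r8,
      Lam_eq, Lam_eq, d1, d3]
    ring
  rw [hk, hl]
  ring

lemma spec2 {r ζ : ℂ} (hr0 : r ≠ 0) (hr : ‖r‖ < 1) (hζ : ζ ^ 4 = -1) :
    Lam4 ζ (r ^ 2) - Lam4 (ζ ^ 3) (r ^ 2) =
      (ζ - ζ ^ 3) * (E (r ^ 2) ^ 2 * E (r ^ 4) * E (r ^ 8) ^ 3 / E (r ^ 16) ^ 2) *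
      (11 + 24 * S (r ^ 2) + 96 * S (r ^ 8) - 384 * S (r ^ 16)) := by
  have hp := norm_pow_lt hr two_ne_zero
  have h4 := norm_pow_lt hr four_ne_zero
  have n8 := norm_pow_lt hr (n := 8) (by norm_num)
  have n16 := norm_pow_lt hr (n := 16) (by norm_num)
  have E1 := E_ne_zero hp
  have E2 := E_ne_zero h4
  have E4 := E_ne_zero n8
  have E8 := E_ne_zero n16
  have z8 : ζ ^ 8 = 1 := by linear_combination (ζ ^ 4 - 1) * hζ
  have nz := norm_I_pow z8
  have nz3 : ‖ζ ^ 3‖ = 1 := by rw [norm_pow, nz, one_pow]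
  have z0 : ζ ≠ 0 := by rintro rfl; norm_num at hζ
  have z30 : ζ ^ 3 ≠ 0 := pow_ne_zero _ z0
  have z1 : ζ ≠ 1 := by rintro rfl; norm_num at hζ
  have z31 : ζ ^ 3 ≠ 1 := by
    intro h
    have : ζ = -1 := by linear_combination hζ - ζ * h
    rw [this] at hζ; norm_num at hζ
  have h := Lam4_diff (a := ζ ^ 3) (c := ζ) hr0 hr z30 z0
    (good_unit nz3 z31 hp) (good_of_norm_lt (norm_div_unit nz3 hp) hp)
    (good_unit nz z1 hp) (good_of_norm_lt (norm_div_unit nz hp) hp)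
  rw [h]
  have i2 : (ζ ^ 2) ^ 2 = -1 := by rw [← hζ]; ring
  have t1 : Th r (ζ ^ 3 * ζ) = 2 * E (r ^ 4) ^ 2 / E (r ^ 2) := by
    have : ζ ^ 3 * ζ = -1 := by rw [← hζ]; ring
    rw [this, Th_neg_one hr0 hr]
  have t2 : Th r (ζ ^ 3 / ζ) = E (r ^ 2) * (1 - ζ ^ 2) * (E (r ^ 8) / E (r ^ 4)) := by
    have : ζ ^ 3 / ζ = ζ ^ 2 := by field_simp
    rw [this, Th_I hr0 hr i2]
  have d1 : r ^ 2 / ζ = -(ζ ^ 3 * r ^ 2) := by field_simp; linear_combination hζ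
  have d3 : r ^ 2 / ζ ^ 3 = -(ζ * r ^ 2) := by field_simp; linear_combination hζ
  have r4 : (r ^ 2) ^ 2 = r ^ 4 := by ring
  have r8 : (r ^ 4) ^ 2 = r ^ 8 := by ring
  have r16 : (r ^ 8) ^ 2 = r ^ 16 := by ring
  have t3 : Th r (ζ ^ 3) * Th r ζ = E (r ^ 2) ^ 2 * (-(ζ + ζ ^ 3)) * (E (r ^ 16) / E (r ^ 8)) := by
    rw [jtp hr0 hr z30, jtp hr0 hr z0, d1, d3, P_succ _ hp, P_succ ζ hp]
    have a1 := P_neg_mul (ζ * r ^ 2) hp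
    have a2 := P_neg_mul (ζ ^ 3 * r ^ 2) hp
    have a3 := P_neg_mul ((ζ * r ^ 2) ^ 2) h4
    have e : (ζ ^ 3 * r ^ 2) ^ 2 = -(ζ * r ^ 2) ^ 2 := by linear_combination ζ ^ 2 * r ^ 4 * hζ
    have e' : ((ζ * r ^ 2) ^ 2) ^ 2 = -(r ^ 8) := by linear_combination r ^ 8 * hζ
    rw [r4] at a1 a2
    rw [e] at a2
    rw [e', r8, P_neg_self' n8, r16] at a3
    rw [← a3, ← a1, ← a2]
    have : (1 - ζ ^ 3) * (1 - ζ) = -(ζ + ζ ^ 3) := by linear_combination hζ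
    rw [← this]
    ring
  have hk : kap r (ζ ^ 3) ζ = -(ζ - ζ ^ 3) * (E (r ^ 2) ^ 2 * E (r ^ 4) * E (r ^ 8) ^ 3 / E (r ^ 16) ^ 2) := by
    unfold kap
    rw [← mul_pow, t3, t1, t2]
    have : (E (r ^ 2) ^ 2 * (-(ζ + ζ ^ 3)) * (E (r ^ 16) / E (r ^ 8))) ^ 2 =
      -2 * (E (r ^ 2) ^ 2 * (E (r ^ 16) / E (r ^ 8))) ^ 2 := by
      have : (ζ + ζ ^ 3) ^ 2 = -2 := by linear_combination (ζ ^ 2 + 2) * hζ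
      rw [mul_right_comm, mul_pow, neg_sq, this]; ring
    rw [this]
    field_simp
  have hl : Lam ζ (r ^ 2) + Lam (ζ ^ 3) (r ^ 2) = -2 - 16 * S (r ^ 8) + 64 * S (r ^ 16) := by
    rw [Lam_eq, Lam_eq, H_succ ζ hp, H_succ (ζ ^ 3) hp, d1, d3]
    have b1 := H_pair (norm_unit_mul nz hp) hp
    have b2 := H_pair (norm_unit_mul nz3 hp) hp
    have nn : ‖(ζ * r ^ 2) ^ 2‖ < 1 := norm_pow_lt (norm_unit_mul nz hp) two_ne_zero
    have b3 := H_pair nn h4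
    have b4 := H_pair n8 n8
    have e : (ζ ^ 3 * r ^ 2) ^ 2 = -(ζ * r ^ 2) ^ 2 := by linear_combination ζ ^ 2 * r ^ 4 * hζ
    have e' : ((ζ * r ^ 2) ^ 2) ^ 2 = -(r ^ 8) := by linear_combination r ^ 8 * hζ
    rw [e, r4] at b2
    rw [r4] at b1
    rw [e', r8] at b3
    rw [r16] at b4
    have c : hh ζ + hh (ζ ^ 3) = -2 := by
      unfold hh
      have m1 : 1 - ζ ≠ 0 := sub_ne_zero.mpr z1.symm
      have m2 : 1 - ζ ^ 3 ≠ 0 := sub_ne_zero.mpr z31.symm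
      field_simp
      linear_combination (2 - 3 * ζ + 2 * ζ ^ 2 - 3 * ζ ^ 3 + 2 * ζ ^ 4) * hζ
    rw [S_eq, S_eq]
    linear_combination c + b1 + b2 + 4 * b3 + 16 * b4
  rw [hk, hl]
  ring

end RF

namespace RF
open Filter Topology

lemma tt_phi {q : ℂ} (hq0 : q ≠ 0) (n : ℤ) : tt q (-q) n = q ^ (n ^ 2) := by
  unfold tt
  have : (-q) ^ n = (-1) ^ n * q ^ n := by rw [← mul_zpow]; simp
  rw [this, zpow_sub₀ hq0]
  have h1 : (-1 : ℂ) ^ n * (-1) ^ n = 1 := by rw [← mul_zpow]; simp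
  have h2 : q ^ n ≠ 0 := zpow_ne_zero _ hq0
  field_simp
  rw [pow_two ((-1 : ℂ) ^ n), h1]

lemma Th_phi {q : ℂ} (hq0 : q ≠ 0) (hq : ‖q‖ < 1) : Th q (-q) = ph q := by
  rw [jtp hq0 hq (neg_ne_zero.mpr hq0)]
  have : q ^ 2 / -q = -q := by field_simp
  rw [this, ph]; ring

lemma summable_phi {q : ℂ} (hq0 : q ≠ 0) (hq : ‖q‖ < 1) :
    Summable fun n : ℤ => ‖q ^ (n ^ 2)‖ := by
  simpa only [tt_phi hq0] using summable_tt hq0 hq (neg_ne_zero.mpr hq0)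

lemma hasSum_phi {q : ℂ} (hq0 : q ≠ 0) (hq : ‖q‖ < 1) :
    HasSum (fun n : ℤ => q ^ (n ^ 2)) (ph q) := by
  have := hasSum_tt hq0 hq (neg_ne_zero.mpr hq0)
  rw [Th_phi hq0 hq] at this
  exact hasSum_congr_fun (fun n => (tt_phi hq0 n).symm) this

/-- splitting integers by parity -/
noncomputable def parZ : ℤ ⊕ ℤ ≃ ℤ :=
  Equiv.ofBijective (Sum.elim (fun k => 2 * k) (fun k => 2 * k + 1)) (by
    constructor
    · rintro (a | a) (c | c) h <;> simp at h ⊢ <;> omega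
    · intro m
      rcases Int.even_or_odd m with ⟨k, hk⟩ | ⟨k, hk⟩
      · exact ⟨Sum.inl k, by simp; omega⟩
      · exact ⟨Sum.inr k, by simp; omega⟩)

lemma parZ_inl (k : ℤ) : parZ (Sum.inl k) = 2 * k := rfl

lemma parZ_inr (k : ℤ) : parZ (Sum.inr k) = 2 * k + 1 := rfl

lemma ph_split {q : ℂ} (hq0 : q ≠ 0) (hq : ‖q‖ < 1) :
    ph q = ph (q ^ 4) + 2 * q * E (q ^ 16) ^ 2 / E (q ^ 8) := by
  have n4 := norm_pow_lt hq four_ne_zero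
  have q4 : q ^ 4 ≠ 0 := pow_ne_zero _ hq0
  have q8 : -(q ^ 4) ^ 2 ≠ 0 := neg_ne_zero.mpr (pow_ne_zero _ q4)
  have h := hasSum_phi hq0 hq
  rw [← parZ.hasSum_iff] at h
  have h1 := hasSum_phi q4 n4
  have h2 := (hasSum_tt q4 n4 q8).mul_left q
  have hz : ∀ n : ℤ, (q ^ 4) ^ n = q ^ (4 * n) := by
    intro n; rw [zpow_mul]; norm_cast
  have h3 : HasSum ((fun n : ℤ => q ^ (n ^ 2)) ∘ parZ) (ph (q ^ 4) + q * Th (q ^ 4) (-(q ^ 4) ^ 2)) := by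
    apply HasSum.sum
    · refine hasSum_congr_fun (fun k => ?_) h1
      simp only [Function.comp, parZ_inl, hz]
      congr 1; ring
    · refine hasSum_congr_fun (fun k => ?_) h2
      simp only [Function.comp, parZ_inr, tt]
      have e : (-(q ^ 4) ^ 2) ^ k = (-1) ^ k * q ^ (8 * k) := by
        have : -(q ^ 4) ^ 2 = (-1) * q ^ 8 := by ring
        rw [this, mul_zpow, zpow_mul]; norm_cast
      have s : (-1 : ℂ) ^ k * (-1) ^ k = 1 := by rw [← mul_zpow]; simp
      rw [e, hz]
      have e2 : q ^ ((2 * k + 1) ^ 2) = q * (q ^ (4 * (k ^ 2 - k)) * q ^ (8 * k)) := by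
        rw [← zpow_add₀ hq0, ← zpow_one_add₀ hq0]; congr 1; ring
      rw [e2]
      linear_combination -(q * (q ^ (4 * (k ^ 2 - k)) * q ^ (8 * k))) * s
  have h4 := h.unique h3
  have h5 := Th_shift (r := q ^ 4) (a := -1) q4 (by norm_num)
  have e : (q ^ 4) ^ 2 * -1 = -(q ^ 4) ^ 2 := by ring
  have r8 : (q ^ 4) ^ 2 = q ^ 8 := by ring
  have r16 : (q ^ 4) ^ 4 = q ^ 16 := by ring
  rw [e, Th_neg_one q4 n4, r8, r16] at h5
  rw [h4, r8]
  linear_combination -q * h5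

lemma phi_sq {q : ℂ} (hq0 : q ≠ 0) (hq : ‖q‖ < 1) :
    ph (q ^ 2) ^ 2 = ph (-q ^ 2) ^ 2 + 8 * q ^ 2 * E (q ^ 16) ^ 4 / E (q ^ 8) ^ 2 := by
  have n2 := norm_pow_lt hq two_ne_zero
  have q2 : q ^ 2 ≠ 0 := pow_ne_zero _ hq0
  have h1 := ph_split q2 n2
  have h2 := ph_split (neg_ne_zero.mpr q2) (by rwa [norm_neg] : ‖-q ^ 2‖ < 1)
  have h3 := ph_eq (norm_pow_lt hq (n := 8) (by norm_num))
  have e1 : (-q ^ 2) ^ 4 = q ^ 8 := by ring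
  have e2 : (-q ^ 2) ^ 16 = q ^ 32 := by ring
  have e3 : (-q ^ 2) ^ 8 = q ^ 16 := by ring
  have e1' : (q ^ 2) ^ 4 = q ^ 8 := by ring
  have e2' : (q ^ 2) ^ 16 = q ^ 32 := by ring
  have e3' : (q ^ 2) ^ 8 = q ^ 16 := by ring
  have e4 : (q ^ 8) ^ 2 = q ^ 16 := by ring
  have e5 : (q ^ 8) ^ 4 = q ^ 32 := by ring
  rw [e1, e2, e3] at h2
  rw [e1', e2', e3'] at h1
  rw [e4, e5] at h3
  have E8 := E_ne_zero (norm_pow_lt hq (n := 8) (by norm_num))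
  have E16 := E_ne_zero (norm_pow_lt hq (n := 16) (by norm_num))
  have E32 := E_ne_zero (norm_pow_lt hq (n := 32) (by norm_num))
  rw [h1, h2, h3]
  field_simp
  ring

lemma master {q ζ : ℂ} (hq0 : q ≠ 0) (hq : ‖q‖ < 1) (hζ : ζ ^ 4 = -1) :
    ph q ^ 6 * ph (q ^ 2) * ph (q ^ 4) =
      64 / 11 * (Lam4 q (q ^ 8) - Lam4 (q ^ 3) (q ^ 8))
      + 2 / 11 * ((Lam4 ζ (q ^ 2) - Lam4 (ζ ^ 3) (q ^ 2)) / (2 * (ζ - ζ ^ 3)))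
      - 28 / 11 * (q * E (q ^ 2) ^ 11 * E (q ^ 8) ^ 2 / (E q ^ 2 * E (q ^ 4) ^ 3))
      + 96 / 11 * (q * E q ^ 2 * E (q ^ 4) ^ 11 / (E (q ^ 2) ^ 3 * E (q ^ 8) ^ 2))
      + 224 / 11 * (q ^ 2 * E (q ^ 4) ^ 11 * E (q ^ 16) ^ 2 / (E (q ^ 2) ^ 2 * E (q ^ 8) ^ 3))
      + 192 / 11 * (q ^ 2 * E (q ^ 2) ^ 2 * E (q ^ 8) ^ 11 / (E (q ^ 4) ^ 3 * E (q ^ 16) ^ 2)) := by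
  have n2 := norm_pow_lt hq two_ne_zero
  have n4 := norm_pow_lt hq four_ne_zero
  have n8 := norm_pow_lt hq (n := 8) (by norm_num)
  have n16 := norm_pow_lt hq (n := 16) (by norm_num)
  have q2 : q ^ 2 ≠ 0 := pow_ne_zero _ hq0
  have q4 : q ^ 4 ≠ 0 := pow_ne_zero _ hq0
  have E1 := E_ne_zero hq
  have E2 := E_ne_zero n2
  have E4 := E_ne_zero n4
  have E8 := E_ne_zero n8
  have E16 := E_ne_zero n16
  have e22 : (q ^ 2) ^ 2 = q ^ 4 := by ring
  have e24 : (q ^ 2) ^ 4 = q ^ 8 := by ring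
  have e42 : (q ^ 4) ^ 2 = q ^ 8 := by ring
  have e44 : (q ^ 4) ^ 4 = q ^ 16 := by ring
  have hw : ζ - ζ ^ 3 ≠ 0 := by
    intro h
    have h2 : ζ ^ 2 = -1 := by linear_combination ζ * h + hζ
    have : ζ ^ 4 = 1 := by linear_combination (ζ ^ 2 - 1) * h2
    rw [this] at hζ; norm_num at hζ
  have pA := ph_eq n4
  have pΦ := ph_eq n2
  have ps := ph_eq hq
  have pd := ph_neg hq
  have pd2 := ph_neg n2
  have sp := ph_split hq0 hq
  have sm := ph_split (neg_ne_zero.mpr hq0) (by rwa [norm_neg] : ‖-q‖ < 1)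
  have e1 : (-q) ^ 4 = q ^ 4 := by ring
  have e2 : (-q) ^ 8 = q ^ 8 := by ring
  have e3 : (-q) ^ 16 = q ^ 16 := by ring
  rw [e1, e2, e3] at sm
  have f1 := four_sq hq0 hq
  have f1m := four_sq_neg hq0 hq
  have f2 := four_sq q2 n2
  have f2m := four_sq_neg q2 n2
  have f4 := four_sq q4 n4
  have e2_16 : (q ^ 2) ^ 4 = q ^ 8 := by ring
  rw [e24] at f2
  rw [e22, e24] at f2m
  rw [e44] at f4
  rw [e22, e24] at pΦ
  rw [e42, e44] at pA
  rw [e22] at pd2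
  have psq := phi_sq hq0 hq
  rw [spec1 hq0 hq, spec2 hq0 hq hζ]
  have hB : ∃ B, B = 2 * q * E (q ^ 16) ^ 2 / E (q ^ 8) := ⟨_, rfl⟩
  obtain ⟨B, hB⟩ := hB
  have sp' : ph q = ph (q ^ 4) + B := by rw [sp, hB]
  have sm' : ph (-q) = ph (q ^ 4) - B := by rw [sm, hB]; ring
  have m1 : 1 + 6 * S q - 6 * S (q ^ 2) - 24 * S (q ^ 8) =
      3 / 4 * ph (q ^ 2) ^ 4 + 1 / 4 * ph q ^ 4 + (ph q ^ 4 - ph (-q) ^ 4) / 4 := by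
    rw [f1, f1m, f2]; ring
  have m2 : 11 + 24 * S (q ^ 2) + 96 * S (q ^ 8) - 384 * S (q ^ 16) =
      12 * ph (q ^ 4) ^ 4 - ph (q ^ 2) ^ 4 + 2 * (ph (q ^ 2) ^ 4 - ph (-q ^ 2) ^ 4) := by
    rw [f4, f2, f2m]; ring
  have hd2 : ph (-q ^ 2) ^ 2 = ph q * ph (-q) := by
    rw [pd2, ps, pd]; field_simp
  have hΦ2 : ph (q ^ 2) ^ 2 = ph (q ^ 4) ^ 2 + B ^ 2 := by
    have : 8 * q ^ 2 * E (q ^ 16) ^ 4 / E (q ^ 8) ^ 2 = 2 * B ^ 2 := by rw [hB]; field_simp; ring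
    rw [psq, hd2, sp', sm', this]; ring
  have k1 : q * E (q ^ 8) ^ 2 * E (q ^ 4) * E (q ^ 2) ^ 3 / E q ^ 2 =
      ph (q ^ 2) * ph (q ^ 4) * B * ph q / 2 := by
    rw [pΦ, pA, ps, hB]; field_simp
  have k2 : E (q ^ 2) ^ 2 * E (q ^ 4) * E (q ^ 8) ^ 3 / E (q ^ 16) ^ 2 =
      ph (q ^ 2) * ph (q ^ 4) * (ph q * ph (-q)) := by
    rw [pΦ, pA, ps, pd]; field_simp
  have k3 : q * E (q ^ 2) ^ 11 * E (q ^ 8) ^ 2 / (E q ^ 2 * E (q ^ 4) ^ 3) =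
      ph (q ^ 2) * ph q * (ph q * ph (-q)) ^ 2 * ph (q ^ 4) * B / 2 := by
    rw [pΦ, pA, ps, pd, hB]; field_simp
  have k4 : q * E q ^ 2 * E (q ^ 4) ^ 11 / (E (q ^ 2) ^ 3 * E (q ^ 8) ^ 2) =
      ph (q ^ 2) * ph (q ^ 2) ^ 2 * ph (-q) * (ph q * ph (-q)) * ph (q ^ 4) * B / 2 := by
    rw [pΦ, pA, ps, pd, hB]; field_simp
  have k5 : q ^ 2 * E (q ^ 4) ^ 11 * E (q ^ 16) ^ 2 / (E (q ^ 2) ^ 2 * E (q ^ 8) ^ 3) =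
      ph (q ^ 2) * ph (q ^ 2) ^ 2 * (ph q * ph (-q)) * ph (q ^ 4) * B ^ 2 / 4 := by
    rw [pΦ, pA, ps, pd, hB]; field_simp; ring
  have k6 : q ^ 2 * E (q ^ 2) ^ 2 * E (q ^ 8) ^ 11 / (E (q ^ 4) ^ 3 * E (q ^ 16) ^ 2) =
      ph (q ^ 2) * (ph q * ph (-q)) * ph (q ^ 4) ^ 3 * B ^ 2 / 4 := by
    rw [pΦ, pA, ps, pd, hB]; field_simp; ring
  have hq4 : ph (q ^ 2) ^ 4 = (ph (q ^ 4) ^ 2 + B ^ 2) ^ 2 := by rw [← hΦ2]; ring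
  have hm4 : ph (-q ^ 2) ^ 4 = (ph q * ph (-q)) ^ 2 := by rw [← hd2]; ring
  rw [k1, k2, k3, k4, k5, k6, m1, m2, hq4, hm4, hΦ2, sp', sm']
  generalize ph (q ^ 2) = Φ
  generalize ph (q ^ 4) = A
  have hx : (ζ - ζ ^ 3) * (Φ * A * ((A + B) * (A - B))) * (12 * A ^ 4 - (A ^ 2 + B ^ 2) ^ 2 + 2 * ((A ^ 2 + B ^ 2) ^ 2 - ((A + B) * (A - B)) ^ 2)) / (2 * (ζ - ζ ^ 3)) =
      (Φ * A * ((A + B) * (A - B))) * (12 * A ^ 4 - (A ^ 2 + B ^ 2) ^ 2 + 2 * ((A ^ 2 + B ^ 2) ^ 2 - ((A + B) * (A - B)) ^ 2)) / 2 := by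
    clear * - hw
    generalize ζ - ζ ^ 3 = w at hw ⊢
    field_simp
  rw [hx]
  ring

end RF

namespace RF
open Filter Topology

/-- `g(x) = ∑ d³ x^d` -/
noncomputable def gg (x : ℂ) : ℂ := hh x + 6 * hh x ^ 2

lemma hasSum_nat_of_pnat {f : ℕ → ℂ} {s : ℂ} (h0 : f 0 = 0) :
    HasSum (fun n : ℕ+ => f n) s ↔ HasSum f s := by
  refine Function.Injective.hasSum_iff (g := ((↑) : ℕ+ → ℕ)) (f := f) PNat.coe_injective ?_
  intro x hx
  rcases Nat.eq_zero_or_pos x with h | h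
  · rw [h, h0]
  · exact absurd ⟨⟨x, h⟩, rfl⟩ hx

lemma hasSum_gg {x : ℂ} (hx : ‖x‖ < 1) : HasSum (fun b : ℕ+ => ((b : ℕ) : ℂ) ^ 3 * x ^ (b : ℕ)) (gg x) := by
  refine (hasSum_nat_of_pnat (f := fun b : ℕ => (b : ℂ) ^ 3 * x ^ b) (by simp)).mpr ?_
  have h0 := hasSum_choose_mul_geometric_of_norm_lt_one 0 hx
  have h1 := hasSum_choose_mul_geometric_of_norm_lt_one 1 hx
  have h2 := hasSum_choose_mul_geometric_of_norm_lt_one 2 hx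
  have h3 := hasSum_choose_mul_geometric_of_norm_lt_one 3 hx
  have hne : (1 - x) ≠ 0 := by
    intro h
    have : x = 1 := by linear_combination -h
    rw [this] at hx; simp at hx
  have key := ((h3.mul_left 6).sub (h2.mul_left 12)).add ((h1.mul_left 7).sub h0)
  have hval : 6 * (1 / (1 - x) ^ (3 + 1)) - 12 * (1 / (1 - x) ^ (2 + 1)) +
      (7 * (1 / (1 - x) ^ (1 + 1)) - 1 / (1 - x) ^ (0 + 1)) = gg x := by
    unfold gg hh
    field_simp
    ring
  rw [hval] at key
  refine hasSum_congr_fun (fun b => ?_) key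
  have c1 : (((b + 1).choose 1 : ℕ) : ℂ) = b + 1 := by simp
  have c2 : (((b + 2).choose 2 : ℕ) : ℂ) = (b + 2) * (b + 1) / 2 := by
    rw [Nat.cast_choose_two]; push_cast; ring
  have c3 : (((b + 3).choose 3 : ℕ) : ℂ) = (b + 3) * (b + 2) * (b + 1) / 6 := by
    have h := Nat.add_one_mul_choose_eq (b + 2) 2
    have h' : ((b : ℂ) + 2 + 1) * ((b + 2).choose 2 : ℕ) = ((b + 3).choose 3 : ℕ) * 3 := by
      exact_mod_cast h
    rw [c2] at h'
    linear_combination -h' / 3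
  rw [c1, c2, c3]
  simp only [Nat.choose_zero_right]
  push_cast
  ring

lemma summable_lam {q : ℂ} (hq : ‖q‖ < 1) (c : ℕ → ℕ → ℂ) (hc : ∀ a b, ‖c a b‖ ≤ (b : ℝ) ^ 3) :
    Summable fun x : ℕ+ × ℕ+ => c x.1 x.2 * q ^ (x.1 * x.2 : ℕ) := by
  have h := (summable_prod_mul_pow 3 hq).norm
  refine Summable.of_norm_bounded h (fun x => ?_)
  rw [norm_mul, norm_mul]
  gcongr
  simpa using hc x.1 x.2

lemma lambert {q : ℂ} (hq : ‖q‖ < 1) (c : ℕ → ℕ → ℂ) (hc : ∀ a b, ‖c a b‖ ≤ (b : ℝ) ^ 3) :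
    HasSum (fun n : ℕ => (∑ d ∈ n.divisors, c (n / d) d) * q ^ n)
      (∑' a : ℕ+, ∑' b : ℕ+, c a b * q ^ (a * b : ℕ)) := by
  have hs := summable_lam hq c hc
  rw [← hs.tsum_prod, ← hasSum_nat_of_pnat (by simp)]
  have h1 := (sigmaAntidiagonalEquivProd.hasSum_iff).mpr hs.hasSum
  have h3 := h1.sigma (g := fun n : ℕ+ => (∑ d ∈ (n : ℕ).divisors, c (n / d) d) * q ^ (n : ℕ)) ?_
  · exact h3
  intro n
  have h4 := hasSum_fintype (fun y : Nat.divisorsAntidiagonal n =>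
    ((fun x : ℕ+ × ℕ+ => c x.1 x.2 * q ^ (x.1 * x.2 : ℕ)) ∘ sigmaAntidiagonalEquivProd) ⟨n, y⟩)
  convert h4 using 1
  simp only [sigmaAntidiagonalEquivProd, divisorsAntidiagonalFactors, Function.comp,
    Equiv.coe_fn_mk, PNat.mk_coe, Finset.univ_eq_attach]
  rw [(n : ℕ).divisorsAntidiagonal.sum_attach (fun x => c x.1 x.2 * q ^ (x.1 * x.2)),
    Nat.sum_divisorsAntidiagonal' (fun x y => c x y * q ^ (x * y)), Finset.sum_mul]
  refine Finset.sum_congr rfl fun i hi => ?_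
  rw [Nat.div_mul_cancel (Nat.dvd_of_mem_divisors hi)]

lemma norm_chi (n : ℕ) : ‖((ZMod.χ₈ (n : ZMod 8) : ℤ) : ℂ)‖ ≤ 1 := by
  rcases ZMod.isQuadratic_χ₈ (n : ZMod 8) with h | h | h <;> simp [h]

lemma summable_gg (x : ℂ) {p : ℂ} (hp : ‖p‖ < 1) : Summable fun n : ℕ => ‖gg (x * p ^ n)‖ := by
  have h1 := summable_hh x hp
  have h2 := (summable_sq h1).mul_left 6
  refine Summable.of_nonneg_of_le (fun _ => norm_nonneg _) (fun n => ?_) (h1.add h2)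
  unfold gg
  refine (norm_add_le _ _).trans ?_
  simp

lemma Lam4_eq (a : ℂ) {p : ℂ} (hp : ‖p‖ < 1) :
    Lam4 a p = ∑' n : ℕ, gg (a * p ^ n) + ∑' n : ℕ, gg (p / a * p ^ n) := by
  have key (x : ℂ) : ∑' n : ℕ, gg (x * p ^ n) = ∑' n : ℕ, hh (x * p ^ n) + 6 * ∑' n : ℕ, hh (x * p ^ n) ^ 2 := by
    have h1 := summable_hh x hp
    have h2 := (summable_sq h1).of_norm
    rw [← tsum_mul_left, ← h1.of_norm.tsum_add (h2.mul_left 6)]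
    rfl
  rw [key, key]
  unfold Lam4 Lam Lam2
  ring

lemma sum_zmod8 (f : ZMod 8 → ℂ) : ∑ j, f j = f 0 + f 1 + f 2 + f 3 + f 4 + f 5 + f 6 + f 7 :=
  Fin.sum_univ_eight f

lemma gen_chiOne {q : ℂ} (hq0 : q ≠ 0) (hq : ‖q‖ < 1) :
    HasSum (fun n : ℕ => ((sigmaChi8One n : ℤ) : ℂ) * q ^ n)
      (Lam4 q (q ^ 8) - Lam4 (q ^ 3) (q ^ 8)) := by
  have h := lambert hq (fun a b => ((ZMod.χ₈ (a : ZMod 8) : ℤ) : ℂ) * (b : ℂ) ^ 3) (fun a b => by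
    rw [norm_mul]
    have := norm_chi a
    calc _ ≤ 1 * ‖(b : ℂ) ^ 3‖ := by gcongr
      _ = _ := by simp)
  convert h using 1
  · ext n
    unfold sigmaChi8One
    push_cast
    rfl
  have e1 : ∀ a : ℕ+, ∑' b : ℕ+, ((ZMod.χ₈ ((a : ℕ) : ZMod 8) : ℤ) : ℂ) * ((b : ℕ) : ℂ) ^ 3 * q ^ (a * b : ℕ)
      = ((ZMod.χ₈ ((a : ℕ) : ZMod 8) : ℤ) : ℂ) * gg (q ^ (a : ℕ)) := by
    intro a
    rw [← (hasSum_gg (norm_pow_lt hq a.pos.ne')).tsum_eq, ← tsum_mul_left]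
    congr 1; ext b
    rw [pow_mul]; ring
  rw [tsum_congr e1]
  have hsum : Summable fun a : ℕ => ((ZMod.χ₈ (a : ZMod 8) : ℤ) : ℂ) * gg (q ^ a) := by
    refine Summable.of_norm_bounded (summable_gg 1 hq) (fun n => ?_)
    rw [norm_mul, one_mul]
    calc _ ≤ 1 * ‖gg (q ^ n)‖ := by gcongr; exact norm_chi n
      _ = _ := one_mul _
  rw [((hasSum_nat_of_pnat (f := fun a : ℕ => ((ZMod.χ₈ (a : ZMod 8) : ℤ) : ℂ) * gg (q ^ a))
    (by simp)).mpr hsum.hasSum).tsum_eq, Nat.sumByResidueClasses hsum 8]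
  have hz : (8 : ZMod 8) = 0 := by decide
  have v0 : ZMod.χ₈ 0 = 0 := by decide
  have v1 : ZMod.χ₈ 1 = 1 := by decide
  have v2 : ZMod.χ₈ 2 = 0 := by decide
  have v3 : ZMod.χ₈ 3 = -1 := by decide
  have v4 : ZMod.χ₈ 4 = 0 := by decide
  have v5 : ZMod.χ₈ 5 = -1 := by decide
  have v6 : ZMod.χ₈ 6 = 0 := by decide
  have v7 : ZMod.χ₈ 7 = 1 := by decide
  have n8 := norm_pow_lt hq (show 8 ≠ 0 by norm_num)
  rw [Lam4_eq _ n8, Lam4_eq _ n8]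
  have d1 : q ^ 8 / q = q ^ 7 := by field_simp
  have d3 : q ^ 8 / q ^ 3 = q ^ 5 := by field_simp
  rw [d1, d3]
  have w (j : ℕ) : ∑' m : ℕ, ((ZMod.χ₈ ((j + 8 * m : ℕ) : ZMod 8) : ℤ) : ℂ) * gg (q ^ (j + 8 * m)) =
      ((ZMod.χ₈ (j : ZMod 8) : ℤ) : ℂ) * ∑' m : ℕ, gg (q ^ j * (q ^ 8) ^ m) := by
    rw [← tsum_mul_left]
    congr 1; ext m
    have : ((j + 8 * m : ℕ) : ZMod 8) = j := by push_cast; rw [hz]; ring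
    rw [this, pow_add, pow_mul]
  simp only [w]
  have hj : ∀ j : ZMod 8, ((j.val : ℕ) : ZMod 8) = j := by decide
  simp only [hj]
  rw [sum_zmod8]
  have w1 : (1 : ZMod 8).val = 1 := by decide
  have w3 : (3 : ZMod 8).val = 3 := by decide
  have w5 : (5 : ZMod 8).val = 5 := by decide
  have w7 : (7 : ZMod 8).val = 7 := by decide
  rw [v0, v1, v2, v3, v4, v5, v6, v7, w1, w3, w5, w7, pow_one]
  push_cast
  ring

lemma zeta_chi {ζ : ℂ} (hζ : ζ ^ 4 = -1) (b : ℕ) :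
    ζ ^ b + (ζ⁻¹) ^ b - (ζ ^ 3) ^ b - ((ζ ^ 3)⁻¹) ^ b = 2 * (ζ - ζ ^ 3) * ((ZMod.χ₈ (b : ZMod 8) : ℤ) : ℂ) := by
  have h8 : ζ ^ 8 = 1 := by linear_combination (ζ ^ 4 - 1) * hζ
  have hi : ζ⁻¹ = ζ ^ 7 := inv_eq_of_mul_eq_one_right (by linear_combination h8)
  have hi3 : (ζ ^ 3)⁻¹ = ζ ^ 5 := inv_eq_of_mul_eq_one_right (by linear_combination h8)
  rw [hi, hi3]
  have h7 : ζ ^ 7 = -ζ ^ 3 := by linear_combination ζ ^ 3 * hζ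
  have h5 : ζ ^ 5 = -ζ := by linear_combination ζ * hζ
  have hb (x : ℂ) (hx : x ^ 8 = 1) : x ^ b = x ^ (b % 8) := by
    conv_lhs => rw [← Nat.div_add_mod b 8, pow_add, pow_mul, hx, one_pow, one_mul]
  have hp (k : ℕ) : (ζ ^ k) ^ b = (ζ ^ k) ^ (b % 8) :=
    hb _ (by rw [← pow_mul, mul_comm, pow_mul, h8, one_pow])
  have hp1 := hp 1
  rw [pow_one] at hp1
  rw [hp 7, hp 3, hp 5, hp1, ZMod.χ₈_nat_eq_if_mod_eight, h7, h5]
  have hm : b % 2 = b % 8 % 2 := by omega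
  rw [hm]
  have hlt : b % 8 < 8 := Nat.mod_lt _ (by norm_num)
  generalize b % 8 = r at hlt
  interval_cases r <;> simp only [Nat.reduceMod, Nat.reduceEqDiff, if_true, if_false, or_true, or_false, one_ne_zero, Int.cast_zero, Int.cast_one, Int.cast_neg]
  · linear_combination (0) * hζ
  · linear_combination (0) * hζ
  · linear_combination (0) * hζ
  · linear_combination ((-2) * ζ ^ 5 + (2) * ζ ^ 1) * hζ
  · linear_combination (0) * hζ
  · linear_combination ((-2) * ζ ^ 11 + (2) * ζ ^ 7 + (-2) * ζ ^ 3 + (2) * ζ ^ 1) * hζ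
  · linear_combination (0) * hζ
  · linear_combination ((-2) * ζ ^ 17 + (2) * ζ ^ 13 + (-2) * ζ ^ 9 + (2) * ζ ^ 5 + (2) * ζ ^ 3 + (-2) * ζ ^ 1) * hζ

lemma hh_zeta {ζ : ℂ} (hζ : ζ ^ 4 = -1) : hh ζ = -(ζ - ζ ^ 3 + 2) / 2 := by
  have h1 : 1 - ζ ≠ 0 := by
    intro h
    have : ζ = 1 := by linear_combination -h
    rw [this] at hζ; norm_num at hζ
  unfold hh
  rw [div_eq_iff (pow_ne_zero 2 h1)]
  linear_combination (1 - ζ / 2) * hζ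

lemma gg_zeta {ζ : ℂ} (hζ : ζ ^ 4 = -1) : gg ζ - gg (ζ ^ 3) = 11 * (ζ - ζ ^ 3) := by
  have h9 : (ζ ^ 3) ^ 3 = ζ := by linear_combination (ζ ^ 5 - ζ) * hζ
  have hw : (ζ - ζ ^ 3) ^ 2 = 2 := by linear_combination (-2 + ζ ^ 2) * hζ
  have h3 := hh_zeta (ζ := ζ ^ 3) (by linear_combination (ζ ^ 8 - ζ ^ 4 + 1) * hζ)
  unfold gg
  rw [h3, hh_zeta hζ, h9]
  ring

lemma gen_oneChi {p ζ : ℂ} (hp : ‖p‖ < 1) (hζ : ζ ^ 4 = -1) :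
    HasSum (fun n : ℕ => ((sigmaOneChi8 n : ℤ) : ℂ) * p ^ n)
      ((Lam4 ζ p - Lam4 (ζ ^ 3) p) / (2 * (ζ - ζ ^ 3)) - 11 / 2) := by
  have h8 : ζ ^ 8 = 1 := by linear_combination (ζ ^ 4 - 1) * hζ
  have hw : ζ - ζ ^ 3 ≠ 0 := by
    intro h
    have h2 : ζ ^ 2 = -1 := by linear_combination ζ * h + hζ
    have : ζ ^ 4 = 1 := by linear_combination (ζ ^ 2 - 1) * h2
    rw [this] at hζ; norm_num at hζ
  have hn : ‖ζ‖ = 1 := norm_I_pow h8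
  have h := lambert hp (fun a b => ((ZMod.χ₈ (b : ZMod 8) : ℤ) : ℂ) * (b : ℂ) ^ 3) (fun a b => by
    rw [norm_mul]
    have := norm_chi b
    calc _ ≤ 1 * ‖(b : ℂ) ^ 3‖ := by gcongr
      _ = _ := by simp)
  convert h using 1
  · ext n
    unfold sigmaOneChi8
    push_cast
    rfl
  have e1 : ∀ a : ℕ+, ∑' b : ℕ+, ((ZMod.χ₈ ((b : ℕ) : ZMod 8) : ℤ) : ℂ) * ((b : ℕ) : ℂ) ^ 3 * p ^ (a * b : ℕ)
      = (gg (ζ * p ^ (a : ℕ)) + gg (ζ⁻¹ * p ^ (a : ℕ)) - gg (ζ ^ 3 * p ^ (a : ℕ)) - gg ((ζ ^ 3)⁻¹ * p ^ (a : ℕ)))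
        / (2 * (ζ - ζ ^ 3)) := by
    intro a
    have hpa := norm_pow_lt hp a.pos.ne'
    have k (x : ℂ) (hx : ‖x‖ = 1) := hasSum_gg (x := x * p ^ (a : ℕ)) (by rw [norm_mul, hx, one_mul]; exact hpa)
    have k1 := k ζ hn
    have k2 := k ζ⁻¹ (by simp [hn])
    have k3 := k (ζ ^ 3) (by simp [hn])
    have k4 := k (ζ ^ 3)⁻¹ (by simp [hn])
    refine HasSum.tsum_eq ?_
    refine hasSum_congr_fun (fun b => ?_) ((((k1.add k2).sub k3).sub k4).div_const (2 * (ζ - ζ ^ 3)))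
    rw [eq_div_iff (mul_ne_zero two_ne_zero hw), mul_pow, mul_pow, mul_pow, mul_pow, pow_mul]
    linear_combination (-((b : ℕ) : ℂ) ^ 3 * (p ^ (a : ℕ)) ^ (b : ℕ)) * zeta_chi hζ b
  rw [tsum_congr e1, tsum_div_const, Lam4_eq _ hp, Lam4_eq _ hp]
  rw [tsum_pnat_eq_tsum_succ (f := fun a : ℕ => gg (ζ * p ^ a) + gg (ζ⁻¹ * p ^ a) - gg (ζ ^ 3 * p ^ a) - gg ((ζ ^ 3)⁻¹ * p ^ a))]
  have s (x : ℂ) : Summable fun n : ℕ => gg (x * p ^ n) := (summable_gg x hp).of_norm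
  have s1 (x : ℂ) : Summable fun n : ℕ => gg (x * p ^ (n + 1)) :=
    (summable_nat_add_iff (f := fun n : ℕ => gg (x * p ^ n)) 1).mpr (s x)
  rw [(((s1 ζ).add (s1 ζ⁻¹)).sub (s1 (ζ ^ 3))).tsum_sub (s1 _), ((s1 ζ).add (s1 ζ⁻¹)).tsum_sub (s1 _),
    (s1 ζ).tsum_add (s1 _), (s ζ).tsum_eq_zero_add, (s (ζ ^ 3)).tsum_eq_zero_add]
  have e (x : ℂ) : ∑' n : ℕ, gg (p / x * p ^ n) = ∑' n : ℕ, gg (x⁻¹ * p ^ (n + 1)) := by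
    congr 1; ext n; congr 1; rw [pow_succ]; ring
  rw [e, e, pow_zero, mul_one, mul_one]
  have hg := gg_zeta hζ
  rw [div_sub' (mul_ne_zero two_ne_zero hw)]
  congr 1
  linear_combination hg

end RF

namespace RF
open Filter Topology

lemma prod_hasSum : ∀ (n : ℕ) (f : Fin n → ℤ → ℂ) (s : Fin n → ℂ),
    (∀ i, Summable fun k => ‖f i k‖) → (∀ i, HasSum (f i) (s i)) →
    (Summable fun x : Fin n → ℤ => ‖∏ i, f i (x i)‖) ∧
    HasSum (fun x : Fin n → ℤ => ∏ i, f i (x i)) (∏ i, s i) := by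
  intro n
  induction n with
  | zero =>
    intro f s _ _
    refine ⟨(hasSum_fintype _).summable, ?_⟩
    simp
  | succ n ih =>
    intro f s hf hs
    obtain ⟨i1, i2⟩ := ih (fun i => f i.succ) (fun i => s i.succ) (fun i => hf _) (fun i => hs _)
    have e : ∀ y : ℤ × (Fin n → ℤ), ∏ i, f i ((Fin.consEquiv (fun _ : Fin (n + 1) => ℤ)) y i) =
        f 0 y.1 * ∏ i : Fin n, f i.succ (y.2 i) := by
      intro y
      rw [Fin.prod_univ_succ]
      simp [Fin.consEquiv]
    constructor
    · rw [← (Fin.consEquiv (fun _ : Fin (n + 1) => ℤ)).summable_iff]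
      refine ((hf 0).mul_norm i1).congr (fun y => ?_)
      simp only [Function.comp]
      rw [e]
    · rw [← (Fin.consEquiv (fun _ : Fin (n + 1) => ℤ)).hasSum_iff, Fin.prod_univ_succ]
      refine hasSum_congr_fun (fun y => e y) ?_
      have hsm : Summable fun y : ℤ × (Fin n → ℤ) => f 0 y.1 * ∏ i : Fin n, f i.succ (y.2 i) :=
        summable_mul_of_summable_norm (f := f 0) (g := fun x : Fin n → ℤ => ∏ i : Fin n, f i.succ (x i)) (hf 0) i1
      exact HasSum.mul (f := f 0) (g := fun x : Fin n → ℤ => ∏ i : Fin n, f i.succ (x i)) (hs 0) i2 hsm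

lemma gen_fiber {X : Type*} (N : X → ℕ) {q s : ℂ} (hq0 : q ≠ 0)
    (h : HasSum (fun x => q ^ N x) s) :
    HasSum (fun n : ℕ => (Nat.card {x // N x = n} : ℂ) * q ^ n) s := by
  have h1 := (Equiv.sigmaFiberEquiv N).hasSum_iff.mpr h
  refine h1.sigma ?_
  intro n
  have h2 : ∀ y : {x // N x = n}, ((fun x => q ^ N x) ∘ (Equiv.sigmaFiberEquiv N)) ⟨n, y⟩ = q ^ n := by
    intro y
    simp [y.2]
  have hs : Summable fun _ : {x // N x = n} => q ^ n := by
    have := h1.summable.sigma_factor n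
    exact this.congr (fun y => (h2 y))
  refine hasSum_congr_fun h2 ?_
  rcases finite_or_infinite {x // N x = n} with hfin | hinf
  · have := Fintype.ofFinite {x // N x = n}
    have h3 := hasSum_fintype (fun _ : {x // N x = n} => q ^ n)
    simpa [Nat.card_eq_fintype_card] using h3
  · exact absurd ((_root_.summable_const_iff (β := {x // N x = n}) (q ^ n)).mp hs) (pow_ne_zero n hq0)

lemma gen_rep {q : ℂ} (hq0 : q ≠ 0) (hq : ‖q‖ < 1) (a : Fin 8 → ℕ) (ha : ∀ i, a i ≠ 0) :
    HasSum (fun n : ℕ => (repCount a n : ℂ) * q ^ n) (∏ i, ph (q ^ a i)) := by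
  have h := (prod_hasSum 8 (fun i k => (q ^ a i) ^ (k ^ 2)) (fun i => ph (q ^ a i))
    (fun i => summable_phi (pow_ne_zero _ hq0) (norm_pow_lt hq (ha i)))
    (fun i => hasSum_phi (pow_ne_zero _ hq0) (norm_pow_lt hq (ha i)))).2
  have hN : ∀ x : Fin 8 → ℤ, ((∑ i, (a i : ℤ) * x i ^ 2).toNat : ℤ) = ∑ i, (a i : ℤ) * x i ^ 2 :=
    fun x => Int.toNat_of_nonneg (Finset.sum_nonneg fun i _ => by positivity)
  have h2 : HasSum (fun x : Fin 8 → ℤ => q ^ (∑ i, (a i : ℤ) * x i ^ 2).toNat) (∏ i, ph (q ^ a i)) := by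
    refine hasSum_congr_fun (fun x => ?_) h
    rw [← zpow_natCast, hN]
    simp only [← zpow_natCast, ← zpow_mul]
    generalize (Finset.univ : Finset (Fin 8)) = t
    induction t using Finset.induction_on with
    | empty => simp
    | insert i t hi ih => rw [Finset.sum_insert hi, Finset.prod_insert hi, zpow_add₀ hq0, ih]
  refine hasSum_congr_fun (fun n => ?_) (gen_fiber _ hq0 h2)
  congr 2
  unfold repCount
  refine Nat.card_congr (Equiv.subtypeEquivRight fun x => ?_)
  rw [← hN x]
  exact Int.natCast_inj

lemma eta_eq {z : ℂ} (k : ℕ) :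
    dedekindEta (k * z) = Complex.exp (2 * Real.pi * Complex.I * z / 24) ^ k *
      E (Complex.exp (2 * Real.pi * Complex.I * z) ^ k) := by
  unfold dedekindEta E P
  congr 1
  · rw [← Complex.exp_nat_mul]; congr 1; ring
  · congr 1; ext m
    rw [← pow_succ', ← pow_mul, ← Complex.exp_nat_mul]
    congr 2; push_cast; ring

lemma norm_exp_lt {z : ℂ} (hz : 0 < z.im) : ‖Complex.exp (2 * Real.pi * Complex.I * z)‖ < 1 := by
  rw [Complex.norm_exp, Real.exp_lt_one_iff]
  simp
  positivity

lemma exists_z {q : ℂ} (hq0 : q ≠ 0) (hq : ‖q‖ < 1) :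
    ∃ z : ℂ, 0 < z.im ∧ Complex.exp (2 * Real.pi * Complex.I * z) = q := by
  have e : 2 * Real.pi * Complex.I * (Complex.log q / (2 * Real.pi * Complex.I)) = Complex.log q := by
    field_simp
  refine ⟨Complex.log q / (2 * Real.pi * Complex.I), ?_, by rw [e, Complex.exp_log hq0]⟩
  have h1 := congrArg Complex.re e
  rw [Complex.log_re] at h1
  have h2 : Real.log ‖q‖ < 0 := Real.log_neg (norm_pos_iff.mpr hq0) hq
  generalize Complex.log q / (2 * Real.pi * Complex.I) = z at h1 ⊢
  simp at h1
  nlinarith [Real.pi_pos]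

lemma hasSum_shift {a : ℕ → ℤ} {q v : ℂ} (hv : v ≠ 0)
    (h : v = ∑' m : ℕ, (a (m + 1) : ℂ) * q ^ (m + 1)) :
    HasSum (fun n : ℕ => (if n = 0 then 0 else (a n : ℂ)) * q ^ n) v := by
  have hs : Summable fun m : ℕ => (a (m + 1) : ℂ) * q ^ (m + 1) := by
    by_contra hns
    rw [tsum_eq_zero_of_not_summable hns] at h
    exact hv h
  have h1 := hs.hasSum
  rw [← h] at h1
  rw [← hasSum_nat_add_iff' 1]
  simpa using h1

lemma eta_one {a : ℕ → ℤ}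
    (ha : ∀ z : ℂ, 0 < z.im →
      dedekindEta z ^ (-2 : ℤ) * dedekindEta (2 * z) ^ (11 : ℤ) * dedekindEta (4 * z) ^ (-3 : ℤ) * dedekindEta (8 * z) ^ (2 : ℤ)
        = ∑' m : ℕ, (a (m + 1) : ℂ) * Complex.exp (2 * Real.pi * Complex.I * z) ^ (m + 1))
    {q : ℂ} (hq0 : q ≠ 0) (hq : ‖q‖ < 1) :
    HasSum (fun n : ℕ => (if n = 0 then 0 else (a n : ℂ)) * q ^ n)
      (q * E (q ^ 2) ^ 11 * E (q ^ 8) ^ 2 / (E q ^ 2 * E (q ^ 4) ^ 3)) := by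
  have E1 := E_ne_zero hq
  have E2 := E_ne_zero (norm_pow_lt hq (show 2 ≠ 0 by norm_num))
  have E4 := E_ne_zero (norm_pow_lt hq (show 4 ≠ 0 by norm_num))
  have E8 := E_ne_zero (norm_pow_lt hq (show 8 ≠ 0 by norm_num))
  obtain ⟨z, hz, rfl⟩ := exists_z hq0 hq
  refine hasSum_shift (by positivity) ?_
  rw [← ha z hz]
  have t1 := eta_eq (z := z) 1
  have t2 := eta_eq (z := z) 2
  have t4 := eta_eq (z := z) 4
  have t8 := eta_eq (z := z) 8
  push_cast at t1 t2 t4 t8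
  rw [one_mul, pow_one, pow_one] at t1
  rw [t1, t2, t4, t8]
  have hx : Complex.exp (2 * Real.pi * Complex.I * z) = Complex.exp (2 * Real.pi * Complex.I * z / 24) ^ 24 := by
    rw [← Complex.exp_nat_mul]; congr 1; push_cast; ring
  have hne := Complex.exp_ne_zero (2 * Real.pi * Complex.I * z / 24)
  have hzp2 (x : ℂ) : x ^ (-2 : ℤ) = 1 / x ^ 2 := by simp [zpow_neg]
  have hzp3 (x : ℂ) : x ^ (-3 : ℤ) = 1 / x ^ 3 := by simp [zpow_neg]
  have hz2 (x : ℂ) : x ^ (2 : ℤ) = x ^ 2 := by norm_cast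
  have hz11 (x : ℂ) : x ^ (11 : ℤ) = x ^ 11 := by norm_cast
  rw [hzp2, hzp3, hz2, hz11]
  rw [div_eq_iff (by positivity)]
  generalize E (Complex.exp (2 * Real.pi * Complex.I * z)) = e1 at *
  generalize E (Complex.exp (2 * Real.pi * Complex.I * z) ^ 2) = e2 at *
  generalize E (Complex.exp (2 * Real.pi * Complex.I * z) ^ 4) = e4 at *
  generalize E (Complex.exp (2 * Real.pi * Complex.I * z) ^ 8) = e8 at *
  rw [hx]
  generalize Complex.exp (2 * Real.pi * Complex.I * z / 24) = y at *
  field_simp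

lemma eta_two {a : ℕ → ℤ}
    (ha : ∀ z : ℂ, 0 < z.im →
      dedekindEta z ^ (2 : ℤ) * dedekindEta (2 * z) ^ (-3 : ℤ) * dedekindEta (4 * z) ^ (11 : ℤ) * dedekindEta (8 * z) ^ (-2 : ℤ)
        = ∑' m : ℕ, (a (m + 1) : ℂ) * Complex.exp (2 * Real.pi * Complex.I * z) ^ (m + 1))
    {q : ℂ} (hq0 : q ≠ 0) (hq : ‖q‖ < 1) :
    HasSum (fun n : ℕ => (if n = 0 then 0 else (a n : ℂ)) * q ^ n)
      (q * E q ^ 2 * E (q ^ 4) ^ 11 / (E (q ^ 2) ^ 3 * E (q ^ 8) ^ 2)) := by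
  have E1 := E_ne_zero hq
  have E2 := E_ne_zero (norm_pow_lt hq (show 2 ≠ 0 by norm_num))
  have E4 := E_ne_zero (norm_pow_lt hq (show 4 ≠ 0 by norm_num))
  have E8 := E_ne_zero (norm_pow_lt hq (show 8 ≠ 0 by norm_num))
  obtain ⟨z, hz, rfl⟩ := exists_z hq0 hq
  refine hasSum_shift (by positivity) ?_
  rw [← ha z hz]
  have t1 := eta_eq (z := z) 1
  have t2 := eta_eq (z := z) 2
  have t4 := eta_eq (z := z) 4
  have t8 := eta_eq (z := z) 8
  push_cast at t1 t2 t4 t8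
  rw [one_mul, pow_one, pow_one] at t1
  rw [t1, t2, t4, t8]
  have hx : Complex.exp (2 * Real.pi * Complex.I * z) = Complex.exp (2 * Real.pi * Complex.I * z / 24) ^ 24 := by
    rw [← Complex.exp_nat_mul]; congr 1; push_cast; ring
  have hne := Complex.exp_ne_zero (2 * Real.pi * Complex.I * z / 24)
  have hzp2 (x : ℂ) : x ^ (-2 : ℤ) = 1 / x ^ 2 := by simp [zpow_neg]
  have hzp3 (x : ℂ) : x ^ (-3 : ℤ) = 1 / x ^ 3 := by simp [zpow_neg]
  have hz2 (x : ℂ) : x ^ (2 : ℤ) = x ^ 2 := by norm_cast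
  have hz11 (x : ℂ) : x ^ (11 : ℤ) = x ^ 11 := by norm_cast
  rw [hzp2, hzp3, hz2, hz11]
  rw [div_eq_iff (by positivity)]
  generalize E (Complex.exp (2 * Real.pi * Complex.I * z)) = e1 at *
  generalize E (Complex.exp (2 * Real.pi * Complex.I * z) ^ 2) = e2 at *
  generalize E (Complex.exp (2 * Real.pi * Complex.I * z) ^ 4) = e4 at *
  generalize E (Complex.exp (2 * Real.pi * Complex.I * z) ^ 8) = e8 at *
  rw [hx]
  generalize Complex.exp (2 * Real.pi * Complex.I * z / 24) = y at *
  field_simp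

lemma hasSum_half {a : ℕ → ℂ} {q v : ℂ} (h : HasSum (fun n : ℕ => a n * (q ^ 2) ^ n) v) :
    HasSum (fun n : ℕ => (if 2 ∣ n then a (n / 2) else 0) * q ^ n) v := by
  have hi : Function.Injective (fun n : ℕ => 2 * n) := fun x y h => by
    simp only at h; omega
  rw [← hi.hasSum_iff]
  · refine hasSum_congr_fun (fun n => ?_) h
    simp [pow_mul]
  · intro n hn
    rw [if_neg, zero_mul]
    rintro ⟨k, rfl⟩
    exact hn ⟨k, rfl⟩

lemma coeff_unique {c : ℕ → ℂ} (h : ∀ q : ℂ, q ≠ 0 → ‖q‖ < 1 → HasSum (fun n => c n * q ^ n) 0) :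
    ∀ n, c n = 0 := by
  classical
  have h1 : HasFPowerSeriesAt (fun z : ℂ => if z = 0 then c 0 else 0)
      (FormalMultilinearSeries.ofScalars ℂ c) 0 := by
    rw [hasFPowerSeriesAt_iff]
    filter_upwards [Metric.ball_mem_nhds (0 : ℂ) one_pos] with z hz
    simp only [FormalMultilinearSeries.coeff_ofScalars, zero_add, smul_eq_mul]
    split_ifs with h0
    · subst h0
      refine hasSum_congr_fun (fun n => ?_) (hasSum_ite_eq (0 : ℕ) (c 0))
      split_ifs with hn
      · simp [hn]
      · simp [hn]
    · refine hasSum_congr_fun (fun n => ?_) (h z h0 (by simpa using hz))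
      ring
  have h2 : Tendsto (fun z : ℂ => if z = 0 then c 0 else 0) (𝓝[≠] 0) (𝓝 (c 0)) := by
    have := h1.continuousAt.tendsto.mono_left (nhdsWithin_le_nhds (s := {0}ᶜ))
    simpa using this
  have h3 : Tendsto (fun z : ℂ => if z = 0 then c 0 else 0) (𝓝[≠] 0) (𝓝 0) := by
    refine tendsto_const_nhds.congr' ?_
    filter_upwards [self_mem_nhdsWithin] with z hz
    exact (if_neg hz).symm
  have h4 : c 0 = 0 := tendsto_nhds_unique h2 h3
  have h5 := h1.eq_zero_of_eventually (Eventually.of_forall fun z => by simp [h4])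
  rw [FormalMultilinearSeries.ofScalars_series_eq_zero] at h5
  exact fun n => congrFun h5 n

end RF

theorem representation_formula_11
    (a1 a2 : ℕ → ℤ)
    (ha1 : ∀ z : ℂ, 0 < z.im →
      dedekindEta z ^ (-2 : ℤ) * dedekindEta (2 * z) ^ (11 : ℤ) * dedekindEta (4 * z) ^ (-3 : ℤ) * dedekindEta (8 * z) ^ (2 : ℤ)
        = ∑' m : ℕ, (a1 (m + 1) : ℂ) * Complex.exp (2 * Real.pi * Complex.I * z) ^ (m + 1))
    (ha2 : ∀ z : ℂ, 0 < z.im →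
      dedekindEta z ^ (2 : ℤ) * dedekindEta (2 * z) ^ (-3 : ℤ) * dedekindEta (4 * z) ^ (11 : ℤ) * dedekindEta (8 * z) ^ (-2 : ℤ)
        = ∑' m : ℕ, (a2 (m + 1) : ℂ) * Complex.exp (2 * Real.pi * Complex.I * z) ^ (m + 1))
    (n : ℕ) (hn : 0 < n) :
    (repCount ![1, 1, 1, 1, 1, 1, 2, 4] n : ℚ) =
    (((64 : ℚ) / 11) * (sigmaChi8One n : ℚ) + ((2 : ℚ) / 11) * half sigmaOneChi8 n
      + ((-28 : ℚ) / 11) * (a1 n : ℚ) + ((96 : ℚ) / 11) * (a2 n : ℚ)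
      + ((224 : ℚ) / 11) * half a1 n + ((192 : ℚ) / 11) * half a2 n) := by
  obtain ⟨ζ, hζ⟩ := IsAlgClosed.exists_pow_nat_eq (-1 : ℂ) (n := 4) (by norm_num)
  have key := RF.coeff_unique (c := fun n : ℕ => (repCount ![1, 1, 1, 1, 1, 1, 2, 4] n : ℂ)
    - (64 / 11 * ((sigmaChi8One n : ℤ) : ℂ)
      + 2 / 11 * (if 2 ∣ n then ((sigmaOneChi8 (n / 2) : ℤ) : ℂ) else 0)
      + (if n = 0 then 1 else 0)
      + (-28 / 11) * (if n = 0 then 0 else (a1 n : ℂ))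
      + 96 / 11 * (if n = 0 then 0 else (a2 n : ℂ))
      + 224 / 11 * (if 2 ∣ n then (if n / 2 = 0 then 0 else (a1 (n / 2) : ℂ)) else 0)
      + 192 / 11 * (if 2 ∣ n then (if n / 2 = 0 then 0 else (a2 (n / 2) : ℂ)) else 0))) ?_ n
  · have hn0 : n ≠ 0 := hn.ne'
    have hq : ((repCount ![1, 1, 1, 1, 1, 1, 2, 4] n : ℚ) : ℂ) =
      ((((64 : ℚ) / 11) * (sigmaChi8One n : ℚ) + ((2 : ℚ) / 11) * half sigmaOneChi8 n
      + ((-28 : ℚ) / 11) * (a1 n : ℚ) + ((96 : ℚ) / 11) * (a2 n : ℚ)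
      + ((224 : ℚ) / 11) * half a1 n + ((192 : ℚ) / 11) * half a2 n : ℚ) : ℂ) := by
      unfold half
      simp only [if_neg hn0] at key
      by_cases h2 : 2 ∣ n
      · have h3 : n / 2 ≠ 0 := by omega
        simp only [if_pos h2, if_neg h3] at key ⊢
        push_cast
        linear_combination key
      · simp only [if_neg h2] at key ⊢
        push_cast
        linear_combination key
    exact_mod_cast hq
  · intro q hq0 hq
    have q20 : q ^ 2 ≠ 0 := pow_ne_zero 2 hq0
    have q2 : ‖q ^ 2‖ < 1 := RF.norm_pow_lt hq two_ne_zero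
    have g0 := RF.gen_rep hq0 hq ![1, 1, 1, 1, 1, 1, 2, 4] (by decide)
    have g1 := (RF.gen_chiOne hq0 hq).mul_left (64 / 11)
    have g2 := (RF.hasSum_half (RF.gen_oneChi q2 hζ)).mul_left (2 / 11)
    have g3 := hasSum_ite_eq (0 : ℕ) (1 : ℂ)
    have g4 := (RF.eta_one ha1 hq0 hq).mul_left (-28 / 11)
    have g5 := (RF.eta_two ha2 hq0 hq).mul_left (96 / 11)
    have g6 := (RF.hasSum_half (RF.eta_one ha1 q20 q2)).mul_left (224 / 11)
    have g7 := (RF.hasSum_half (RF.eta_two ha2 q20 q2)).mul_left (192 / 11)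
    have g := g0.sub ((((((g1.add g2).add g3).add g4).add g5).add g6).add g7)
    have m := RF.master hq0 hq hζ
    have e : (∏ i, RF.ph (q ^ (![1, 1, 1, 1, 1, 1, 2, 4] : Fin 8 → ℕ) i)) = RF.ph q ^ 6 * RF.ph (q ^ 2) * RF.ph (q ^ 4) := by
      rw [Fin.prod_univ_eight]
      change RF.ph (q ^ 1) * RF.ph (q ^ 1) * RF.ph (q ^ 1) * RF.ph (q ^ 1) * RF.ph (q ^ 1) * RF.ph (q ^ 1)
        * RF.ph (q ^ 2) * RF.ph (q ^ 4) = _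
      rw [pow_one]
      ring
    have x4 : (q ^ 2) ^ 2 = q ^ 4 := by ring
    have x8 : (q ^ 2) ^ 4 = q ^ 8 := by ring
    have x16 : (q ^ 2) ^ 8 = q ^ 16 := by ring
    rw [e, m, x4, x8, x16] at g
    convert RF.hasSum_congr_fun (fun n => ?_) g using 1
    · ring
    · by_cases h0 : n = 0
      · subst h0; simp
      · simp only [if_neg h0]
        ring
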